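/- arXiv:1610.02438 — 4 statements merged into one kernel-verified Lean document; each statement's English description precedes it below -/
import Mathlib

section
/- Fix an integer N. For every n ≥ 1, the assignments σ_k : a_k ↦ T_k^N a_{k+1}, a_{k+1} ↦ a_k, a_k^* ↦ a_{k+1}^* T_k^{−N}, a_{k+1}^* ↦ a_k^*, and a_i ↦ a_i, a_i^* ↦ a_i^* for i ≠ k, k+1 (with σ_k swapping the objects k and k+1 and fixing the other objects) define well-defined invertible k-linear endofunctors of Ã^{(n)} satisfying the braid relations σ_kσ_{k+1}σ_k = σ_{k+1}σ_kσ_{k+1} and σ_kσ_j = σ_jσ_k for |k−j| ≥ 2; hence they define a left action of B_n on Ã^{(n)}. For N = 1 this is the GMV action. -/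
/-!
STATEMENT 13: For a fixed integer N, the assignments σ_k : a_k ↦ T_k^N a_{k+1},
a_{k+1} ↦ a_k, a_k^* ↦ a_{k+1}^* T_k^{−N}, a_{k+1}^* ↦ a_k^* (swapping objects
k and k+1, fixing the other objects and generators) define well-defined
invertible k-linear endofunctors of Ã^{(n)} satisfying the braid relations,
hence a left action of B_n on Ã^{(n)}. For N = 1 this is the GMV action.
-/

/-- The braid relations among the generators `σ_1, …, σ_m` (indexed by `Fin m`). -/
def braidRels (m : ℕ) : Set (FreeGroup (Fin m)) :=
  {r | (∃ i j : Fin m, (i : ℕ) + 1 = (j : ℕ) ∧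
          r = FreeGroup.of i * FreeGroup.of j * FreeGroup.of i *
              (FreeGroup.of j * FreeGroup.of i * FreeGroup.of j)⁻¹) ∨
       (∃ i j : Fin m, (i : ℕ) + 2 ≤ (j : ℕ) ∧
          r = FreeGroup.of i * FreeGroup.of j * (FreeGroup.of i)⁻¹ * (FreeGroup.of j)⁻¹)}

/-- The braid group `B_n` on `n` strands. -/
abbrev BraidGroup (n : ℕ) : Type := PresentedGroup (braidRels (n - 1))

/-- The standard generator `σ_i` of `B_n`. -/
def braidGen {n : ℕ} (i : Fin (n - 1)) : BraidGroup n := PresentedGroup.of i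

/-- Generators of the `k`-category `Ã^{(n)}` (encoded as a `k`-algebra with
idempotents `e_i` corresponding to the objects `{0, 1, …, n}`): the identities
`e_i`, the arrows `a_i : i → 0` and `a_i^* : 0 → i`, and the formal inverses
`t_i` of the endomorphisms `T_i = e₀ + a_i a_i^*` of the object `0`. -/
inductive TGen (n : ℕ) : Type
  | e : Fin (n + 1) → TGen n
  | a : Fin n → TGen n
  | as : Fin n → TGen n
  | t : Fin n → TGen n

variable (k : Type) [CommRing k]

/-- The defining relations of `Ã^{(n)}`: the `e_i` are orthogonal idempotents
summing to `1` (encoding the objects), the arrows are placed in the correct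
hom-components (`a_i = e₀ a_i e_i` etc., where object `i ∈ {1,…,n}` is encoded as
`(i : Fin n).succ`), and `t_i` is a two-sided inverse of `T_i = e₀ + a_i a_i^*`
in the endomorphism algebra of the object `0`. -/
inductive TRel (n : ℕ) : FreeAlgebra k (TGen n) → FreeAlgebra k (TGen n) → Prop
  | idem (i : Fin (n + 1)) :
      TRel n (FreeAlgebra.ι k (TGen.e i) * FreeAlgebra.ι k (TGen.e i)) (FreeAlgebra.ι k (TGen.e i))
  | orth (i j : Fin (n + 1)) (h : i ≠ j) :
      TRel n (FreeAlgebra.ι k (TGen.e i) * FreeAlgebra.ι k (TGen.e j)) 0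
  | esum : TRel n (∑ i : Fin (n + 1), FreeAlgebra.ι k (TGen.e i)) 1
  | aL (i : Fin n) :
      TRel n (FreeAlgebra.ι k (TGen.e 0) * FreeAlgebra.ι k (TGen.a i)) (FreeAlgebra.ι k (TGen.a i))
  | aR (i : Fin n) :
      TRel n (FreeAlgebra.ι k (TGen.a i) * FreeAlgebra.ι k (TGen.e i.succ)) (FreeAlgebra.ι k (TGen.a i))
  | asL (i : Fin n) :
      TRel n (FreeAlgebra.ι k (TGen.e i.succ) * FreeAlgebra.ι k (TGen.as i)) (FreeAlgebra.ι k (TGen.as i))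
  | asR (i : Fin n) :
      TRel n (FreeAlgebra.ι k (TGen.as i) * FreeAlgebra.ι k (TGen.e 0)) (FreeAlgebra.ι k (TGen.as i))
  | tL (i : Fin n) :
      TRel n (FreeAlgebra.ι k (TGen.e 0) * FreeAlgebra.ι k (TGen.t i)) (FreeAlgebra.ι k (TGen.t i))
  | tR (i : Fin n) :
      TRel n (FreeAlgebra.ι k (TGen.t i) * FreeAlgebra.ι k (TGen.e 0)) (FreeAlgebra.ι k (TGen.t i))
  | tinvR (i : Fin n) :
      TRel n ((FreeAlgebra.ι k (TGen.e 0) + FreeAlgebra.ι k (TGen.a i) * FreeAlgebra.ι k (TGen.as i)) *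
        FreeAlgebra.ι k (TGen.t i)) (FreeAlgebra.ι k (TGen.e 0))
  | tinvL (i : Fin n) :
      TRel n (FreeAlgebra.ι k (TGen.t i) *
        (FreeAlgebra.ι k (TGen.e 0) + FreeAlgebra.ι k (TGen.a i) * FreeAlgebra.ι k (TGen.as i)))
        (FreeAlgebra.ι k (TGen.e 0))

/-- The `k`-category `Ã^{(n)}` (the localized path category), encoded as a
`k`-algebra with idempotents: the `n`-fold fusion coproduct of copies of `Ã`. -/
abbrev TAlg (n : ℕ) : Type := RingQuot (TRel k n)

/-- The idempotent `e_i` corresponding to the object `i ∈ {0, 1, …, n}`. -/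
noncomputable def eT (n : ℕ) (i : Fin (n + 1)) : TAlg k n :=
  RingQuot.mkAlgHom k (TRel k n) (FreeAlgebra.ι k (TGen.e i))

/-- The generating morphism `a_i : i → 0`. -/
noncomputable def aT (n : ℕ) (i : Fin n) : TAlg k n :=
  RingQuot.mkAlgHom k (TRel k n) (FreeAlgebra.ι k (TGen.a i))

/-- The generating morphism `a_i^* : 0 → i`. -/
noncomputable def asT (n : ℕ) (i : Fin n) : TAlg k n :=
  RingQuot.mkAlgHom k (TRel k n) (FreeAlgebra.ι k (TGen.as i))

/-- The inverse `T_i^{-1}` of `T_i`. -/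
noncomputable def tinvT (n : ℕ) (i : Fin n) : TAlg k n :=
  RingQuot.mkAlgHom k (TRel k n) (FreeAlgebra.ι k (TGen.t i))

/-- The invertible endomorphism `T_i = e₀ + a_i a_i^*` of the object `0`. -/
noncomputable def TT (n : ℕ) (i : Fin n) : TAlg k n :=
  eT k n 0 + aT k n i * asT k n i

/-- The strand `i` (as an index in `Fin n`). -/
def lo {n : ℕ} (i : Fin (n - 1)) : Fin n := ⟨i.1, by have := i.isLt; omega⟩
/-- The strand `i+1` (as an index in `Fin n`). -/
def hi {n : ℕ} (i : Fin (n - 1)) : Fin n := ⟨i.1 + 1, by have := i.isLt; omega⟩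

/-- The Gelfand–MacPherson–Vilonen assignments for the generator `σ_i` acting on
`Ã^{(n)}`: it swaps the objects `i` and `i+1`, fixes the other objects, and sends
`a_i ↦ T_i a_{i+1}`, `a_{i+1} ↦ a_i`, `a_i^* ↦ a_{i+1}^* T_i^{-1}`,
`a_{i+1}^* ↦ a_i^*`, fixing `a_j, a_j^*` for `j ≠ i, i+1`. -/
def IsGMVAt (n : ℕ) (i : Fin (n - 1)) (σ : TAlg k n → TAlg k n) : Prop :=
  σ (eT k n 0) = eT k n 0 ∧
  σ (eT k n (lo i).succ) = eT k n (hi i).succ ∧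
  σ (eT k n (hi i).succ) = eT k n (lo i).succ ∧
  (∀ j : Fin n, j ≠ lo i → j ≠ hi i → σ (eT k n j.succ) = eT k n j.succ) ∧
  σ (aT k n (lo i)) = TT k n (lo i) * aT k n (hi i) ∧
  σ (aT k n (hi i)) = aT k n (lo i) ∧
  σ (asT k n (lo i)) = asT k n (hi i) * tinvT k n (lo i) ∧
  σ (asT k n (hi i)) = asT k n (lo i) ∧
  (∀ j : Fin n, j ≠ lo i → j ≠ hi i →
    σ (aT k n j) = aT k n j ∧ σ (asT k n j) = asT k n j)

/-- The integer power `T_i^N` of the invertible endomorphism `T_i` (using the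
formal inverse `t_i` for negative exponents). -/
noncomputable def tpow (n : ℕ) (i : Fin n) (N : ℤ) : TAlg k n :=
  if 0 ≤ N then (TT k n i) ^ N.toNat else (tinvT k n i) ^ (-N).toNat

/-- The `N`-twisted GMV assignments for the generator `σ_i` acting on `Ã^{(n)}`:
it swaps the objects `i` and `i+1`, fixes the other objects, and sends
`a_i ↦ T_i^N a_{i+1}`, `a_{i+1} ↦ a_i`, `a_i^* ↦ a_{i+1}^* T_i^{-N}`,
`a_{i+1}^* ↦ a_i^*`, fixing `a_j, a_j^*` for `j ≠ i, i+1`. -/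
def IsGMVNAt (N : ℤ) (n : ℕ) (i : Fin (n - 1)) (σ : TAlg k n → TAlg k n) : Prop :=
  σ (eT k n 0) = eT k n 0 ∧
  σ (eT k n (lo i).succ) = eT k n (hi i).succ ∧
  σ (eT k n (hi i).succ) = eT k n (lo i).succ ∧
  (∀ j : Fin n, j ≠ lo i → j ≠ hi i → σ (eT k n j.succ) = eT k n j.succ) ∧
  σ (aT k n (lo i)) = tpow k n (lo i) N * aT k n (hi i) ∧
  σ (aT k n (hi i)) = aT k n (lo i) ∧
  σ (asT k n (lo i)) = asT k n (hi i) * tpow k n (lo i) (-N) ∧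
  σ (asT k n (hi i)) = asT k n (lo i) ∧
  (∀ j : Fin n, j ≠ lo i → j ≠ hi i →
    σ (aT k n j) = aT k n j ∧ σ (asT k n j) = asT k n j)

section Relations

variable {n : ℕ}

theorem eT_completeOrthogonalIdempotents : CompleteOrthogonalIdempotents (eT k n) where
  idem i := by
    simpa [IsIdempotentElem, eT] using RingQuot.mkAlgHom_rel k (TRel.idem (k := k) i)
  ortho i j h := by
    simpa [eT] using RingQuot.mkAlgHom_rel k (TRel.orth (k := k) i j h)
  complete := by
    simpa [eT] using RingQuot.mkAlgHom_rel k (TRel.esum (k := k) (n := n))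

theorem eT_mul_aT (i : Fin n) : eT k n 0 * aT k n i = aT k n i := by
  simpa [eT, aT] using RingQuot.mkAlgHom_rel k (TRel.aL (k := k) i)

theorem aT_mul_eT (i : Fin n) : aT k n i * eT k n i.succ = aT k n i := by
  simpa [eT, aT] using RingQuot.mkAlgHom_rel k (TRel.aR (k := k) i)

theorem eT_mul_asT (i : Fin n) : eT k n i.succ * asT k n i = asT k n i := by
  simpa [eT, asT] using RingQuot.mkAlgHom_rel k (TRel.asL (k := k) i)

theorem asT_mul_eT (i : Fin n) : asT k n i * eT k n 0 = asT k n i := by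
  simpa [eT, asT] using RingQuot.mkAlgHom_rel k (TRel.asR (k := k) i)

theorem eT_mul_tinvT (i : Fin n) : eT k n 0 * tinvT k n i = tinvT k n i := by
  simpa [eT, tinvT] using RingQuot.mkAlgHom_rel k (TRel.tL (k := k) i)

theorem tinvT_mul_eT (i : Fin n) : tinvT k n i * eT k n 0 = tinvT k n i := by
  simpa [eT, tinvT] using RingQuot.mkAlgHom_rel k (TRel.tR (k := k) i)

theorem TT_mul_tinvT (i : Fin n) : TT k n i * tinvT k n i = eT k n 0 := by
  simpa [TT, eT, aT, asT, tinvT] using RingQuot.mkAlgHom_rel k (TRel.tinvR (k := k) i)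

theorem tinvT_mul_TT (i : Fin n) : tinvT k n i * TT k n i = eT k n 0 := by
  simpa [TT, eT, aT, asT, tinvT] using RingQuot.mkAlgHom_rel k (TRel.tinvL (k := k) i)

/-- The unit `1 + a_i a_i^*` of the whole algebra, extending `T_i` by the identity on the
objects different from `0`. -/
noncomputable def TUnit (i : Fin n) : (TAlg k n)ˣ where
  val := 1 + aT k n i * asT k n i
  inv := tinvT k n i + (1 - eT k n 0)
  val_inv := by
    have h := TT_mul_tinvT k i
    rw [TT, add_mul, eT_mul_tinvT] at h
    rw [add_mul, one_mul, mul_add, mul_sub, mul_one, mul_assoc _ _ (eT k n 0), asT_mul_eT,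
      sub_self, add_zero, add_right_comm, h]
    abel
  inv_val := by
    have h := tinvT_mul_TT k i
    rw [TT, mul_add, tinvT_mul_eT] at h
    rw [mul_add, mul_one, add_mul, sub_mul, one_mul, ← mul_assoc (eT k n 0), eT_mul_aT,
      sub_self, add_zero, add_right_comm, h]
    abel

theorem TUnit_val (i : Fin n) : (TUnit k i : TAlg k n) = 1 + aT k n i * asT k n i := rfl

theorem TUnit_inv_val (i : Fin n) :
    ((TUnit k i)⁻¹ : (TAlg k n)ˣ) = tinvT k n i + (1 - eT k n 0) := rfl

theorem commute_TUnit (i : Fin n) : Commute (TUnit k i : TAlg k n) (eT k n 0) := by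
  simp [Commute, SemiconjBy, TUnit_val, add_mul, mul_add, mul_assoc, asT_mul_eT,
    ← mul_assoc (eT k n 0), eT_mul_aT]

theorem commute_TUnit_zpow (i : Fin n) (N : ℤ) :
    Commute ((TUnit k i ^ N : (TAlg k n)ˣ) : TAlg k n) (eT k n 0) :=
  (commute_TUnit k i).units_zpow_left N

end Relations

theorem pow_mul_eq_of_commute {R : Type*} [Monoid R] {x y e : R} (h : x * e = y * e)
    (hy : Commute y e) (m : ℕ) : x ^ m * e = y ^ m * e := by
  induction m with
  | zero => simp
  | succ m ih => rw [pow_succ, mul_assoc, h, hy.eq, ← mul_assoc, ih, mul_assoc, ← hy.eq,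
      ← mul_assoc, ← pow_succ]

section Powers

variable {n : ℕ}

theorem commute_TT (i : Fin n) : Commute (TT k n i) (eT k n 0) := by
  simp [Commute, SemiconjBy, TT, add_mul, mul_add, mul_assoc, asT_mul_eT,
    ← mul_assoc (eT k n 0), eT_mul_aT]

theorem tpow_mul_eT (i : Fin n) (N : ℤ) :
    tpow k n i N * eT k n 0 = (TUnit k i ^ N : (TAlg k n)ˣ) * eT k n 0 := by
  have he : eT k n 0 * eT k n 0 = eT k n 0 := (eT_completeOrthogonalIdempotents k).idem 0
  rcases le_or_gt 0 N with hN | hN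
  · lift N to ℕ using hN
    have h : TT k n i * eT k n 0 = TUnit k i * eT k n 0 := by
      rw [TT, TUnit_val, add_mul, add_mul, he, one_mul]
    simpa [tpow] using pow_mul_eq_of_commute h (commute_TUnit k i) N
  · obtain ⟨m, rfl⟩ : ∃ m : ℕ, N = -m := ⟨(-N).toNat, by omega⟩
    have h : tinvT k n i * eT k n 0 = ((TUnit k i)⁻¹ : (TAlg k n)ˣ) * eT k n 0 := by
      rw [TUnit_inv_val, add_mul, sub_mul, he, one_mul, sub_self, add_zero]
    have := pow_mul_eq_of_commute h (commute_TUnit k i).units_inv_left m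
    rw [tpow, if_neg (by omega)]
    simpa using this

theorem commute_tpow (i : Fin n) (N : ℤ) : Commute (tpow k n i N) (eT k n 0) := by
  unfold tpow
  split_ifs
  · exact (commute_TT k i).pow_left _
  · refine Commute.pow_left ?_ _
    rw [Commute, SemiconjBy, tinvT_mul_eT, eT_mul_tinvT]

theorem tpow_mul_aT (i j : Fin n) (N : ℤ) :
    tpow k n i N * aT k n j = (TUnit k i ^ N : (TAlg k n)ˣ) * aT k n j := by
  rw [← eT_mul_aT k j, ← mul_assoc, tpow_mul_eT, mul_assoc]

theorem asT_mul_tpow (i j : Fin n) (N : ℤ) :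
    asT k n j * tpow k n i N = asT k n j * (TUnit k i ^ N : (TAlg k n)ˣ) := by
  rw [← asT_mul_eT k j, mul_assoc, ← (commute_tpow k i N).eq, tpow_mul_eT,
    (commute_TUnit_zpow k i N).eq, mul_assoc]

end Powers

section UniversalProperty

variable {k} {n : ℕ} {B : Type*} [Ring B] [Algebra k B]

/-- Images of the generators of `Ã^{(n)}` in an algebra, with the `T_i` going to units. -/
structure TRep (e : Fin (n + 1) → B) (a as : Fin n → B) (u : Fin n → Bˣ) : Prop where
  idem : CompleteOrthogonalIdempotents e
  aL (i : Fin n) : e 0 * a i = a i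
  aR (i : Fin n) : a i * e i.succ = a i
  asL (i : Fin n) : e i.succ * as i = as i
  asR (i : Fin n) : as i * e 0 = as i
  unit (i : Fin n) : (u i : B) = 1 + a i * as i

/-- The values of a morphism out of `Ã^{(n)}` on generators. -/
def TGen.value (e : Fin (n + 1) → B) (a as : Fin n → B) (u : Fin n → Bˣ) : TGen n → B
  | .e i => e i
  | .a i => a i
  | .as i => as i
  | .t i => ((u i)⁻¹ : Bˣ) * e 0

variable {e : Fin (n + 1) → B} {a as : Fin n → B} {u : Fin n → Bˣ}

theorem TRep.commute (h : TRep e a as u) (i : Fin n) : Commute (u i : B) (e 0) := by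
  simp [Commute, SemiconjBy, h.unit, add_mul, mul_add, mul_assoc, h.asR, ← mul_assoc (e 0), h.aL]

theorem TRep.corner (h : TRep e a as u) (i : Fin n) : e 0 + a i * as i = u i * e 0 := by
  rw [h.unit, add_mul, one_mul, mul_assoc, h.asR]

/-- The morphism out of `Ã^{(n)}` with prescribed values on generators. -/
noncomputable def TRep.lift (h : TRep e a as u) : TAlg k n →ₐ[k] B :=
  RingQuot.liftAlgHom k ⟨FreeAlgebra.lift k (TGen.value e a as u), by
    have he : e 0 * e 0 = e 0 := h.idem.idem 0
    intro x y r
    cases r with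
    | idem i => simpa [TGen.value] using (h.idem.idem i).eq
    | orth i j hij => simpa [TGen.value] using h.idem.ortho hij
    | esum => simpa [TGen.value] using h.idem.complete
    | aL i => simpa [TGen.value] using h.aL i
    | aR i => simpa [TGen.value] using h.aR i
    | asL i => simpa [TGen.value] using h.asL i
    | asR i => simpa [TGen.value] using h.asR i
    | tL i =>
      simp [TGen.value, ← mul_assoc, ← (h.commute i).units_inv_left.eq]
      simp [mul_assoc, he]
    | tR i => simp [TGen.value, mul_assoc, he]
    | tinvR i =>
      simp [TGen.value, h.corner]
      rw [mul_assoc, ← mul_assoc (e 0), ← (h.commute i).units_inv_left.eq, mul_assoc, he]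
      simp
    | tinvL i =>
      simp [TGen.value, h.corner]
      rw [(h.commute i).eq, mul_assoc, ← mul_assoc (e 0), he, ← (h.commute i).eq]
      simp⟩

theorem TRep.lift_eT (h : TRep e a as u) (i : Fin (n + 1)) :
    h.lift (eT k n i) = e i := by
  simp [TRep.lift, eT, TGen.value]

theorem TRep.lift_aT (h : TRep e a as u) (i : Fin n) : h.lift (aT k n i) = a i := by
  simp [TRep.lift, aT, TGen.value]

theorem TRep.lift_asT (h : TRep e a as u) (i : Fin n) : h.lift (asT k n i) = as i := by
  simp [TRep.lift, asT, TGen.value]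

theorem TAlg.algHom_ext {f g : TAlg k n →ₐ[k] B} (he : ∀ i, f (eT k n i) = g (eT k n i))
    (ha : ∀ i, f (aT k n i) = g (aT k n i)) (has : ∀ i, f (asT k n i) = g (asT k n i)) :
    f = g := by
  have hT (i : Fin n) : f (TT k n i) = g (TT k n i) := by simp [TT, he, ha, has]
  have ht (i : Fin n) : f (tinvT k n i) = g (tinvT k n i) := calc
    f (tinvT k n i) = f (tinvT k n i) * g (TT k n i * tinvT k n i) := by
      rw [TT_mul_tinvT, ← he, ← map_mul, tinvT_mul_eT]
    _ = f (tinvT k n i * TT k n i) * g (tinvT k n i) := by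
      rw [map_mul, map_mul, hT, mul_assoc]
    _ = g (tinvT k n i) := by rw [tinvT_mul_TT, he, ← map_mul, eT_mul_tinvT]
  apply RingQuot.ringQuot_ext'
  apply FreeAlgebra.hom_ext
  funext x
  cases x with
  | e i => exact he i
  | a i => exact ha i
  | as i => exact has i
  | t i => exact ht i

end UniversalProperty

section Twists

variable {k} {n : ℕ}

/-- `f` permutes the objects `1, …, n` by `p` and sends `a_i` to `v_i a_{p i}` and `a_i^*` to
`a_{p i}^* v_i⁻¹`. -/
structure IsTwist (f : TAlg k n →ₐ[k] TAlg k n) (p : Equiv.Perm (Fin n))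
    (v : Fin n → (TAlg k n)ˣ) : Prop where
  map_zero : f (eT k n 0) = eT k n 0
  map_succ (i : Fin n) : f (eT k n i.succ) = eT k n (p i).succ
  map_aT (i : Fin n) : f (aT k n i) = v i * aT k n (p i)
  map_asT (i : Fin n) : f (asT k n i) = asT k n (p i) * ((v i)⁻¹ : (TAlg k n)ˣ)

theorem exists_isTwist (p : Equiv.Perm (Fin n)) (v : Fin n → (TAlg k n)ˣ)
    (hv : ∀ i, Commute (v i : TAlg k n) (eT k n 0)) :
    ∃ f : TAlg k n →ₐ[k] TAlg k n, IsTwist f p v := by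
  have h : TRep (eT k n ∘ Equiv.Perm.decomposeFin.symm (0, p)) (fun i => v i * aT k n (p i))
      (fun i => asT k n (p i) * ((v i)⁻¹ : (TAlg k n)ˣ))
      (fun i => v i * TUnit k (p i) * (v i)⁻¹) :=
    { idem := (CompleteOrthogonalIdempotents.equiv _).mpr (eT_completeOrthogonalIdempotents k)
      aL i := by simp [← mul_assoc, ← (hv i).eq]; simp [mul_assoc, eT_mul_aT]
      aR i := by simp [mul_assoc, aT_mul_eT]
      asL i := by simp [← mul_assoc, eT_mul_asT]
      asR i := by simp [mul_assoc, (hv i).units_inv_left.eq]; simp [← mul_assoc, asT_mul_eT]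
      unit i := by simp [TUnit_val, mul_add, add_mul, mul_assoc] }
  exact ⟨h.lift, by simp [h.lift_eT], fun i => by simp [h.lift_eT], h.lift_aT, h.lift_asT⟩

theorem IsTwist.map_TUnit {f : TAlg k n →ₐ[k] TAlg k n} {p v} (h : IsTwist f p v) (i : Fin n) :
    Units.map (f : TAlg k n →* TAlg k n) (TUnit k i) = v i * TUnit k (p i) * (v i)⁻¹ := by
  ext
  simp [TUnit_val, h.map_aT, h.map_asT, mul_add, add_mul, mul_assoc]

theorem IsTwist.comp {f g : TAlg k n →ₐ[k] TAlg k n} {p q v w} (hf : IsTwist f p v)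
    (hg : IsTwist g q w) : IsTwist (f.comp g) (p * q)
      (fun i => Units.map (f : TAlg k n →* TAlg k n) (w i) * v (q i)) where
  map_zero := by simp [hg.map_zero, hf.map_zero]
  map_succ i := by simp [hg.map_succ, hf.map_succ]
  map_aT i := by simp [hg.map_aT, hf.map_aT, mul_assoc]
  map_asT i := by simp [hg.map_asT, hf.map_asT, mul_assoc, ← map_inv]

theorem IsTwist.id : IsTwist (AlgHom.id k (TAlg k n)) 1 1 := by
  constructor <;> simp

theorem IsTwist.unique {f g : TAlg k n →ₐ[k] TAlg k n} {p q v w} (hf : IsTwist f p v)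
    (hg : IsTwist g q w) (hp : p = q) (hv : ∀ i, v i = w i) : f = g := by
  subst hp
  obtain rfl : v = w := funext hv
  refine TAlg.algHom_ext (fun i => ?_) (fun i => by rw [hf.map_aT, hg.map_aT])
    (fun i => by rw [hf.map_asT, hg.map_asT])
  cases i using Fin.cases with
  | zero => rw [hf.map_zero, hg.map_zero]
  | succ i => rw [hf.map_succ, hg.map_succ]

/-- `f` exchanges strands `x` and `y` with the twist `T_x^N`. -/
abbrev IsHalfTwist (N : ℤ) (x y : Fin n) (f : TAlg k n →ₐ[k] TAlg k n) : Prop :=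
  IsTwist f (Equiv.swap x y) (fun i => if i = x then TUnit k x ^ N else 1)

theorem exists_isHalfTwist (N : ℤ) {x y : Fin n} (hxy : x ≠ y) :
    ∃ f : TAlg k n ≃ₐ[k] TAlg k n, IsHalfTwist N x y (f : TAlg k n →ₐ[k] TAlg k n) := by
  have hc (z : Fin n) (M : ℤ) (i : Fin n) :
      Commute ((if i = z then TUnit k z ^ M else 1 : (TAlg k n)ˣ) : TAlg k n) (eT k n 0) := by
    split_ifs
    · exact commute_TUnit_zpow k z M
    · simp
  obtain ⟨f, hf⟩ := exists_isTwist (Equiv.swap x y) _ (hc x N)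
  obtain ⟨g, hg⟩ := exists_isTwist (Equiv.swap x y) _ (hc y (-N))
  have hfg : f.comp g = AlgHom.id k _ := by
    refine (hf.comp hg).unique .id (by simp) fun i => ?_
    rcases eq_or_ne i x with rfl | hx
    · simp [hxy, hxy.symm]
    rcases eq_or_ne i y with rfl | hy
    · simp [hxy.symm, hf.map_TUnit]
    simp [hx, hy, Equiv.swap_apply_of_ne_of_ne]
  have hgf : g.comp f = AlgHom.id k _ := by
    refine (hg.comp hf).unique .id (by simp) fun i => ?_
    rcases eq_or_ne i x with rfl | hx
    · simp [hxy, hg.map_TUnit]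
    rcases eq_or_ne i y with rfl | hy
    · simp [hxy, hxy.symm]
    simp [hx, hy, Equiv.swap_apply_of_ne_of_ne]
  exact ⟨AlgEquiv.ofAlgHom f g hfg hgf, hf⟩

theorem IsHalfTwist.braid {N : ℤ} {x y z : Fin n} (hxy : x ≠ y) (hxz : x ≠ z) (hyz : y ≠ z)
    {f g : TAlg k n →ₐ[k] TAlg k n} (hf : IsHalfTwist N x y f) (hg : IsHalfTwist N y z g) :
    f.comp (g.comp f) = g.comp (f.comp g) := by
  refine (hf.comp (hg.comp hf)).unique (hg.comp (hf.comp hg)) ?_ fun i => ?_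
  · ext i
    simp only [Equiv.Perm.mul_apply, Equiv.swap_apply_def]
    grind
  have hx : Equiv.swap y z x = x := Equiv.swap_apply_of_ne_of_ne hxy hxz
  have hz : Equiv.swap x y z = z := Equiv.swap_apply_of_ne_of_ne hxz.symm hyz.symm
  rcases eq_or_ne i x with rfl | h1
  · simp [hxy, hxy.symm, hxz.symm, hf.map_TUnit, hg.map_TUnit, hx]
  rcases eq_or_ne i y with rfl | h2
  · simp [hxy, hxy.symm, hxz.symm, hyz.symm, hf.map_TUnit, hg.map_TUnit, hx, hz]
  rcases eq_or_ne i z with rfl | h3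
  · simp [hxy, hxy.symm, hxz.symm, hyz.symm, hz]
  simp [h1, h2, h3, Equiv.swap_apply_of_ne_of_ne]

theorem IsHalfTwist.comm {N : ℤ} {x y z w : Fin n} (hxz : x ≠ z) (hxw : x ≠ w)
    (hyz : y ≠ z) (hyw : y ≠ w) {f g : TAlg k n →ₐ[k] TAlg k n} (hf : IsHalfTwist N x y f)
    (hg : IsHalfTwist N z w g) : f.comp g = g.comp f := by
  refine (hf.comp hg).unique (hg.comp hf) ?_ fun i => ?_
  · ext i
    simp only [Equiv.Perm.mul_apply, Equiv.swap_apply_def]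
    grind
  have hx : Equiv.swap z w x = x := Equiv.swap_apply_of_ne_of_ne hxz hxw
  have hy : Equiv.swap z w y = y := Equiv.swap_apply_of_ne_of_ne hyz hyw
  have hz : Equiv.swap x y z = z := Equiv.swap_apply_of_ne_of_ne hxz.symm hyz.symm
  have hw : Equiv.swap x y w = w := Equiv.swap_apply_of_ne_of_ne hxw.symm hyw.symm
  have hs : Equiv.swap z w i = x ↔ i = x := by
    rw [Equiv.swap_apply_eq_iff, hx]
  have ht : Equiv.swap x y i = z ↔ i = z := by
    rw [Equiv.swap_apply_eq_iff, hz]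
  rcases eq_or_ne i x with rfl | h1
  · simp [hxz, hx, hg.map_TUnit, hyz]
  rcases eq_or_ne i z with rfl | h2
  · simp [hxz.symm, hz, hf.map_TUnit, hxw.symm]
  simp [h1, h2, hs, ht]

theorem IsHalfTwist.isGMVNAt {N : ℤ} {i : Fin (n - 1)} {f : TAlg k n →ₐ[k] TAlg k n}
    (hf : IsHalfTwist N (lo i) (hi i) f) : IsGMVNAt k N n i f := by
  have h : hi i ≠ lo i := by simp [lo, hi]
  refine ⟨hf.map_zero, ?_, ?_, fun j h1 h2 => ?_, ?_, ?_, ?_, ?_, fun j h1 h2 => ⟨?_, ?_⟩⟩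
  · simp [hf.map_succ]
  · simp [hf.map_succ]
  · simp [hf.map_succ, Equiv.swap_apply_of_ne_of_ne h1 h2]
  · simp [hf.map_aT, tpow_mul_aT]
  · simp [hf.map_aT, h]
  · simp [hf.map_asT, asT_mul_tpow]
  · simp [hf.map_asT, h]
  · simp [hf.map_aT, h1, Equiv.swap_apply_of_ne_of_ne h1 h2]
  · simp [hf.map_asT, h1, Equiv.swap_apply_of_ne_of_ne h1 h2]

end Twists

theorem statement13 (N : ℤ) (n : ℕ) :
    ∃ σ : Fin (n - 1) → (TAlg k n ≃ₐ[k] TAlg k n),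
      -- the defining assignments (well-defined invertible k-linear endofunctors)
      (∀ i : Fin (n - 1), IsGMVNAt k N n i (σ i)) ∧
      -- the braid relations
      (∀ i j : Fin (n - 1), (i : ℕ) + 1 = (j : ℕ) →
        ∀ x, σ i (σ j (σ i x)) = σ j (σ i (σ j x))) ∧
      (∀ i j : Fin (n - 1), (i : ℕ) + 2 ≤ (j : ℕ) →
        ∀ x, σ i (σ j x) = σ j (σ i x)) ∧
      -- hence a left action of B_n on Ã^{(n)}
      ∃ ρ : BraidGroup n →* (TAlg k n ≃ₐ[k] TAlg k n),
        ∀ i : Fin (n - 1), ρ (braidGen i) = σ i := by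
  have hne (i : Fin (n - 1)) : lo i ≠ hi i := by simp [lo, hi]
  choose σ hσ using fun i : Fin (n - 1) => exists_isHalfTwist (k := k) N (hne i)
  have hbraid (i j : Fin (n - 1)) (hij : (i : ℕ) + 1 = (j : ℕ)) (x) :
      σ i (σ j (σ i x)) = σ j (σ i (σ j x)) := by
    have hj : hi i = lo j := Fin.ext hij
    have hi' := hσ i
    rw [hj] at hi'
    refine DFunLike.congr_fun (IsHalfTwist.braid ?_ ?_ (hne j) hi' (hσ j)) x <;>
      simp [lo, hi, Fin.ext_iff] <;> omega
  have hcomm (i j : Fin (n - 1)) (hij : (i : ℕ) + 2 ≤ (j : ℕ)) (x) :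
      σ i (σ j x) = σ j (σ i x) := by
    refine DFunLike.congr_fun (IsHalfTwist.comm ?_ ?_ ?_ ?_ (hσ i) (hσ j)) x <;>
      simp [lo, hi, Fin.ext_iff] <;> omega
  refine ⟨σ, fun i => (hσ i).isGMVNAt, hbraid, hcomm, PresentedGroup.toGroup (f := σ) ?_,
    fun i => PresentedGroup.toGroup.of _⟩
  rintro r (⟨i, j, hij, rfl⟩ | ⟨i, j, hij, rfl⟩)
  · simp only [map_mul, map_inv, FreeGroup.lift_apply_of]
    rw [mul_inv_eq_one]
    exact AlgEquiv.ext (hbraid i j hij)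
  · simp only [map_mul, map_inv, FreeGroup.lift_apply_of]
    rw [mul_inv_eq_one, mul_inv_eq_iff_eq_mul]
    exact AlgEquiv.ext (hcomm i j hij)
end

section
/- Let B be a unital associative k-algebra and x, y ∈ B invertible elements with xy = yx. Then for every n ≥ 1 the assignments σ_k : a_k ↦ x_k a_{k+1}, a_k^* ↦ a_{k+1}^* x_k^{-1}, b_k ↦ x_k b_{k+1} x_k^{-1} (for every b ∈ B), a_{k+1} ↦ y_k a_k, a_{k+1}^* ↦ a_k^* y_k^{-1}, b_{k+1} ↦ y_k b_k y_k^{-1} (for every b ∈ B), together with a_i ↦ a_i, a_i^* ↦ a_i^*, b_i ↦ b_i for i ≠ k, k+1 (with σ_k swapping the objects k and k+1 and fixing the other objects), define well-defined invertible k-linear endofunctors of the pointed k-category Â^{(n)} satisfying the braid relations σ_kσ_{k+1}σ_k = σ_{k+1}σ_kσ_{k+1} and σ_kσ_j = σ_jσ_k for |k−j| ≥ 2; hence they define a left action of B_n on Â^{(n)}. -/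
/-- Generators of the pointed `k`-category `Â^{(n)}` (encoded as a `k`-algebra
with idempotents `e_i` for the objects `{0,1,…,n}`): the identities `e_i`, the
freely adjoined arrows `a_i : i → 0` and `a_i^* : 0 → i`, and for each `i` a copy
`b_i(x)` (`x ∈ B`) of the algebra `B` inside the endomorphisms of the object `0`
(the free product `B^{*n} ⊆ End(0)`). -/
inductive HGen (B : Type) (n : ℕ) : Type
  | e : Fin (n + 1) → HGen B n
  | a : Fin n → HGen B n
  | as : Fin n → HGen B n
  | b : Fin n → B → HGen B n

variable (k B : Type) [CommRing k] [Ring B] [Algebra k B]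

/-- The defining relations of `Â^{(n)}`: the `e_i` are orthogonal idempotents
summing to `1`, the arrows sit in the correct hom-components, and each
`b_i : B → e₀·Â^{(n)}·e₀` is a `k`-algebra homomorphism (with `b_i(1) = e₀`),
so that `End(0)` contains the free product `B^{*n}`. -/
inductive HRel (n : ℕ) : FreeAlgebra k (HGen B n) → FreeAlgebra k (HGen B n) → Prop
  | idem (i : Fin (n + 1)) :
      HRel n (FreeAlgebra.ι k (HGen.e i) * FreeAlgebra.ι k (HGen.e i)) (FreeAlgebra.ι k (HGen.e i))
  | orth (i j : Fin (n + 1)) (h : i ≠ j) :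
      HRel n (FreeAlgebra.ι k (HGen.e i) * FreeAlgebra.ι k (HGen.e j)) 0
  | esum : HRel n (∑ i : Fin (n + 1), FreeAlgebra.ι k (HGen.e i)) 1
  | aL (i : Fin n) :
      HRel n (FreeAlgebra.ι k (HGen.e 0) * FreeAlgebra.ι k (HGen.a i)) (FreeAlgebra.ι k (HGen.a i))
  | aR (i : Fin n) :
      HRel n (FreeAlgebra.ι k (HGen.a i) * FreeAlgebra.ι k (HGen.e i.succ)) (FreeAlgebra.ι k (HGen.a i))
  | asL (i : Fin n) :
      HRel n (FreeAlgebra.ι k (HGen.e i.succ) * FreeAlgebra.ι k (HGen.as i)) (FreeAlgebra.ι k (HGen.as i))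
  | asR (i : Fin n) :
      HRel n (FreeAlgebra.ι k (HGen.as i) * FreeAlgebra.ι k (HGen.e 0)) (FreeAlgebra.ι k (HGen.as i))
  | bL (i : Fin n) (x : B) :
      HRel n (FreeAlgebra.ι k (HGen.e 0) * FreeAlgebra.ι k (HGen.b i x)) (FreeAlgebra.ι k (HGen.b i x))
  | bR (i : Fin n) (x : B) :
      HRel n (FreeAlgebra.ι k (HGen.b i x) * FreeAlgebra.ι k (HGen.e 0)) (FreeAlgebra.ι k (HGen.b i x))
  | badd (i : Fin n) (x y : B) :
      HRel n (FreeAlgebra.ι k (HGen.b i (x + y)))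
        (FreeAlgebra.ι k (HGen.b i x) + FreeAlgebra.ι k (HGen.b i y))
  | bmul (i : Fin n) (x y : B) :
      HRel n (FreeAlgebra.ι k (HGen.b i (x * y)))
        (FreeAlgebra.ι k (HGen.b i x) * FreeAlgebra.ι k (HGen.b i y))
  | bone (i : Fin n) :
      HRel n (FreeAlgebra.ι k (HGen.b i 1)) (FreeAlgebra.ι k (HGen.e 0))
  | bsmul (i : Fin n) (c : k) (x : B) :
      HRel n (FreeAlgebra.ι k (HGen.b i (c • x))) (c • FreeAlgebra.ι k (HGen.b i x))

/-- The pointed `k`-category `Â^{(n)}` (pointed at the object `0`), encoded as a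
`k`-algebra with idempotents: the `n`-fold fusion coproduct of copies of `Â`. -/
abbrev HAlg (n : ℕ) : Type := RingQuot (HRel k B n)

/-- The idempotent `e_i` corresponding to the object `i ∈ {0,1,…,n}`. -/
noncomputable def eH (n : ℕ) (i : Fin (n + 1)) : HAlg k B n :=
  RingQuot.mkAlgHom k (HRel k B n) (FreeAlgebra.ι k (HGen.e i))

/-- The generating morphism `a_i : i → 0`. -/
noncomputable def aH (n : ℕ) (i : Fin n) : HAlg k B n :=
  RingQuot.mkAlgHom k (HRel k B n) (FreeAlgebra.ι k (HGen.a i))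

/-- The generating morphism `a_i^* : 0 → i`. -/
noncomputable def asH (n : ℕ) (i : Fin n) : HAlg k B n :=
  RingQuot.mkAlgHom k (HRel k B n) (FreeAlgebra.ι k (HGen.as i))

/-- The image `b_i = x_i` of `x ∈ B` in the `i`-th free factor of
`B^{*n} ⊆ End(0)`. -/
noncomputable def bH (n : ℕ) (i : Fin n) (x : B) : HAlg k B n :=
  RingQuot.mkAlgHom k (HRel k B n) (FreeAlgebra.ι k (HGen.b i x))

/-- The Crisp–Paris-type assignments for the generator `σ_i` acting on `Â^{(n)}`
(for invertible commuting `x, y ∈ B`): it swaps the objects `i` and `i+1`, fixes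
the other objects, and sends `a_i ↦ x_i a_{i+1}`, `a_i^* ↦ a_{i+1}^* x_i^{-1}`,
`b_i ↦ x_i b_{i+1} x_i^{-1}`, `a_{i+1} ↦ y_i a_i`, `a_{i+1}^* ↦ a_i^* y_i^{-1}`,
`b_{i+1} ↦ y_i b_i y_i^{-1}`, fixing `a_j, a_j^*, b_j` for `j ≠ i, i+1`. -/
def IsCPAt (x y : Bˣ) (n : ℕ) (i : Fin (n - 1)) (σ : HAlg k B n → HAlg k B n) : Prop :=
  σ (eH k B n 0) = eH k B n 0 ∧
  σ (eH k B n (lo i).succ) = eH k B n (hi i).succ ∧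
  σ (eH k B n (hi i).succ) = eH k B n (lo i).succ ∧
  (∀ j : Fin n, j ≠ lo i → j ≠ hi i → σ (eH k B n j.succ) = eH k B n j.succ) ∧
  σ (aH k B n (lo i)) = bH k B n (lo i) (x : B) * aH k B n (hi i) ∧
  σ (asH k B n (lo i)) = asH k B n (hi i) * bH k B n (lo i) ((x⁻¹ : Bˣ) : B) ∧
  (∀ z : B, σ (bH k B n (lo i) z) =
    bH k B n (lo i) (x : B) * bH k B n (hi i) z * bH k B n (lo i) ((x⁻¹ : Bˣ) : B)) ∧
  σ (aH k B n (hi i)) = bH k B n (lo i) (y : B) * aH k B n (lo i) ∧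
  σ (asH k B n (hi i)) = asH k B n (lo i) * bH k B n (lo i) ((y⁻¹ : Bˣ) : B) ∧
  (∀ z : B, σ (bH k B n (hi i) z) =
    bH k B n (lo i) (y : B) * bH k B n (lo i) z * bH k B n (lo i) ((y⁻¹ : Bˣ) : B)) ∧
  (∀ j : Fin n, j ≠ lo i → j ≠ hi i →
    σ (aH k B n j) = aH k B n j ∧ σ (asH k B n j) = asH k B n j ∧
    ∀ z : B, σ (bH k B n j z) = bH k B n j z)

namespace HAlg

variable {k B} {n : ℕ}

/-! ### The defining relations in `HAlg k B n` -/

lemma e_idem (i : Fin (n + 1)) : eH k B n i * eH k B n i = eH k B n i := by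
  simpa only [map_mul, eH] using RingQuot.mkAlgHom_rel k (HRel.idem (k := k) (B := B) i)

lemma e_orth {i j : Fin (n + 1)} (h : i ≠ j) : eH k B n i * eH k B n j = 0 := by
  simpa only [map_mul, map_zero, eH] using
    RingQuot.mkAlgHom_rel k (HRel.orth (k := k) (B := B) i j h)

lemma e_sum : ∑ i, eH k B n i = 1 := by
  simpa only [map_sum, map_one, eH] using RingQuot.mkAlgHom_rel k (HRel.esum (k := k) (B := B))

@[simp]
lemma e_mul_a (i : Fin n) : eH k B n 0 * aH k B n i = aH k B n i := by
  simpa only [map_mul, eH, aH] using RingQuot.mkAlgHom_rel k (HRel.aL (k := k) (B := B) i)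

lemma a_mul_e (i : Fin n) : aH k B n i * eH k B n i.succ = aH k B n i := by
  simpa only [map_mul, eH, aH] using RingQuot.mkAlgHom_rel k (HRel.aR (k := k) (B := B) i)

lemma e_mul_as (i : Fin n) : eH k B n i.succ * asH k B n i = asH k B n i := by
  simpa only [map_mul, eH, asH] using RingQuot.mkAlgHom_rel k (HRel.asL (k := k) (B := B) i)

@[simp]
lemma as_mul_e (i : Fin n) : asH k B n i * eH k B n 0 = asH k B n i := by
  simpa only [map_mul, eH, asH] using RingQuot.mkAlgHom_rel k (HRel.asR (k := k) (B := B) i)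

@[simp]
lemma e_mul_b (i : Fin n) (z : B) : eH k B n 0 * bH k B n i z = bH k B n i z := by
  simpa only [map_mul, eH, bH] using RingQuot.mkAlgHom_rel k (HRel.bL (k := k) i z)

@[simp]
lemma b_mul_e (i : Fin n) (z : B) : bH k B n i z * eH k B n 0 = bH k B n i z := by
  simpa only [map_mul, eH, bH] using RingQuot.mkAlgHom_rel k (HRel.bR (k := k) i z)

lemma b_add (i : Fin n) (z w : B) : bH k B n i (z + w) = bH k B n i z + bH k B n i w := by
  simpa only [map_add, bH] using RingQuot.mkAlgHom_rel k (HRel.badd (k := k) i z w)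

lemma b_mul (i : Fin n) (z w : B) : bH k B n i (z * w) = bH k B n i z * bH k B n i w := by
  simpa only [map_mul, bH] using RingQuot.mkAlgHom_rel k (HRel.bmul (k := k) i z w)

@[simp]
lemma b_one (i : Fin n) : bH k B n i 1 = eH k B n 0 := by
  simpa only [eH, bH] using RingQuot.mkAlgHom_rel k (HRel.bone (k := k) (B := B) i)

lemma b_smul (i : Fin n) (c : k) (z : B) : bH k B n i (c • z) = c • bH k B n i z := by
  simpa only [map_smul, bH] using RingQuot.mkAlgHom_rel k (HRel.bsmul i c z)

@[simp]
lemma e_mul_b_assoc (i : Fin n) (z : B) (w : HAlg k B n) :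
    eH k B n 0 * (bH k B n i z * w) = bH k B n i z * w := by
  rw [← mul_assoc, e_mul_b]

@[simp]
lemma b_mul_inv_b (i : Fin n) (x : Bˣ) :
    bH k B n i x * bH k B n i ((x⁻¹ : Bˣ) : B) = eH k B n 0 := by
  rw [← b_mul, Units.mul_inv, b_one]

@[simp]
lemma b_inv_mul_b (i : Fin n) (x : Bˣ) :
    bH k B n i ((x⁻¹ : Bˣ) : B) * bH k B n i x = eH k B n 0 := by
  rw [← b_mul, Units.inv_mul, b_one]

@[simp]
lemma b_inv_mul_b_assoc (i : Fin n) (x : Bˣ) (w : HAlg k B n) :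
    bH k B n i ((x⁻¹ : Bˣ) : B) * (bH k B n i x * w) = eH k B n 0 * w := by
  rw [← mul_assoc, b_inv_mul_b]

lemma b_conj (i : Fin n) (x y : Bˣ) (h : (x : B) * y = y * x) :
    bH k B n i y * (bH k B n i x * bH k B n i ((y⁻¹ : Bˣ) : B)) = bH k B n i x := by
  rw [← b_mul, ← b_mul, ← mul_assoc, ← h, mul_assoc, Units.mul_inv, mul_one]

lemma hom_ext {φ ψ : HAlg k B n →ₐ[k] HAlg k B n}
    (he : ∀ i, φ (eH k B n i) = ψ (eH k B n i)) (ha : ∀ i, φ (aH k B n i) = ψ (aH k B n i))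
    (has : ∀ i, φ (asH k B n i) = ψ (asH k B n i))
    (hb : ∀ i z, φ (bH k B n i z) = ψ (bH k B n i z)) : φ = ψ := by
  apply RingQuot.ringQuot_ext'
  apply FreeAlgebra.hom_ext
  funext g
  cases g with
  | e i => exact he i
  | a i => exact ha i
  | as i => exact has i
  | b i z => exact hb i z

/-! ### Twisted permutations of the copies of `Â` -/

/-- A pair of mutually inverse elements of the corner algebra `End(0) = e₀ · Â^{(n)} · e₀`. -/
structure IsInvPair (u v : HAlg k B n) : Prop where
  e_mul_left : eH k B n 0 * u = u
  left_mul_e : u * eH k B n 0 = u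
  e_mul_right : eH k B n 0 * v = v
  right_mul_e : v * eH k B n 0 = v
  mul_eq : u * v = eH k B n 0
  mul_eq' : v * u = eH k B n 0

lemma IsInvPair.unique {u v w : HAlg k B n} (h : IsInvPair u v) (h' : IsInvPair u w) : v = w := by
  rw [← h.right_mul_e, ← h'.mul_eq, ← mul_assoc, h.mul_eq', h'.e_mul_right]

lemma IsInvPair.e : IsInvPair (eH k B n 0) (eH k B n 0) := by
  constructor <;> exact e_idem 0

lemma IsInvPair.b (i : Fin n) (x : Bˣ) :
    IsInvPair (bH k B n i x) (bH k B n i ((x⁻¹ : Bˣ) : B)) := by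
  constructor <;> simp

lemma IsInvPair.mul {u v u' v' : HAlg k B n} (h : IsInvPair u v) (h' : IsInvPair u' v') :
    IsInvPair (u * u') (v' * v) where
  e_mul_left := by rw [← mul_assoc, h.e_mul_left]
  left_mul_e := by rw [mul_assoc, h'.left_mul_e]
  e_mul_right := by rw [← mul_assoc, h'.e_mul_right]
  right_mul_e := by rw [mul_assoc, h.right_mul_e]
  mul_eq := by rw [mul_assoc, ← mul_assoc u', h'.mul_eq, h.e_mul_right, h.mul_eq]
  mul_eq' := by rw [mul_assoc, ← mul_assoc v, h.mul_eq', h'.e_mul_left, h'.mul_eq']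

lemma IsInvPair.map {u v : HAlg k B n} (h : IsInvPair u v) {φ : HAlg k B n →ₐ[k] HAlg k B n}
    (hφ : φ (eH k B n 0) = eH k B n 0) : IsInvPair (φ u) (φ v) where
  e_mul_left := by rw [← hφ, ← map_mul, h.e_mul_left]
  left_mul_e := by rw [← hφ, ← map_mul, h.left_mul_e]
  e_mul_right := by rw [← hφ, ← map_mul, h.e_mul_right]
  right_mul_e := by rw [← hφ, ← map_mul, h.right_mul_e]
  mul_eq := by rw [← map_mul, h.mul_eq, hφ]
  mul_eq' := by rw [← map_mul, h.mul_eq', hφ]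

/-- The endomorphism `φ` permutes the copies of `Â` by `π`, twisting the `i`-th copy by the
automorphism `u i` (with inverse `v i`) of the object `0`. -/
structure IsTwist (φ : HAlg k B n →ₐ[k] HAlg k B n) (π : Equiv.Perm (Fin n))
    (u v : Fin n → HAlg k B n) : Prop where
  inv (i : Fin n) : IsInvPair (u i) (v i)
  map_e_zero : φ (eH k B n 0) = eH k B n 0
  map_e (i : Fin n) : φ (eH k B n i.succ) = eH k B n (π i).succ
  map_a (i : Fin n) : φ (aH k B n i) = u i * aH k B n (π i)
  map_as (i : Fin n) : φ (asH k B n i) = asH k B n (π i) * v i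
  map_b (i : Fin n) (z : B) : φ (bH k B n i z) = u i * bH k B n (π i) z * v i

lemma IsTwist.id : IsTwist (AlgHom.id k (HAlg k B n)) 1 (fun _ => eH k B n 0)
    (fun _ => eH k B n 0) := by
  constructor <;> simp [IsInvPair.e]

lemma IsTwist.comp {φ ψ : HAlg k B n →ₐ[k] HAlg k B n} {π ϖ : Equiv.Perm (Fin n)}
    {u v u' v' : Fin n → HAlg k B n} (hφ : IsTwist φ π u v) (hψ : IsTwist ψ ϖ u' v') :
    IsTwist (φ.comp ψ) (π * ϖ) (fun i => φ (u' i) * u (ϖ i)) (fun i => v (ϖ i) * φ (v' i)) where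
  inv i := ((hψ.inv i).map hφ.map_e_zero).mul (hφ.inv _)
  map_e_zero := by simp [hφ.map_e_zero, hψ.map_e_zero]
  map_e i := by simp [hφ.map_e, hψ.map_e]
  map_a i := by simp [hφ.map_a, hψ.map_a, mul_assoc]
  map_as i := by simp [hφ.map_as, hψ.map_as, mul_assoc]
  map_b i z := by simp [hφ.map_b, hψ.map_b, mul_assoc]

lemma IsTwist.ext {φ ψ : HAlg k B n →ₐ[k] HAlg k B n} {π ϖ : Equiv.Perm (Fin n)}
    {u v u' v' : Fin n → HAlg k B n} (hφ : IsTwist φ π u v) (hψ : IsTwist ψ ϖ u' v')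
    (hπ : ∀ i, π i = ϖ i) (hu : ∀ i, u i = u' i) : φ = ψ := by
  obtain rfl : u = u' := funext hu
  obtain rfl : v = v' := funext fun i => (hφ.inv i).unique (hψ.inv i)
  apply hom_ext
  · intro i
    cases i using Fin.cases with
    | zero => rw [hφ.map_e_zero, hψ.map_e_zero]
    | succ i => rw [hφ.map_e, hψ.map_e, hπ]
  · intro i
    rw [hφ.map_a, hψ.map_a, hπ]
  · intro i
    rw [hφ.map_as, hψ.map_as, hπ]
  · intro i z
    rw [hφ.map_b, hψ.map_b, hπ]

/-- The images of the generators under a twisted permutation. -/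
noncomputable def twistGen (π : Equiv.Perm (Fin n)) (u v : Fin n → HAlg k B n) :
    HGen B n → HAlg k B n
  | .e i => Fin.cases (eH k B n 0) (fun j => eH k B n (π j).succ) i
  | .a i => u i * aH k B n (π i)
  | .as i => asH k B n (π i) * v i
  | .b i z => u i * bH k B n (π i) z * v i

lemma twistGen_rel {π : Equiv.Perm (Fin n)} {u v : Fin n → HAlg k B n}
    (h : ∀ i, IsInvPair (u i) (v i)) ⦃f g : FreeAlgebra k (HGen B n)⦄ (r : HRel k B n f g) :
    FreeAlgebra.lift k (twistGen π u v) f = FreeAlgebra.lift k (twistGen π u v) g := by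
  cases r with
  | idem i => cases i using Fin.cases <;> simp [twistGen, e_idem]
  | orth i j hij =>
    cases i using Fin.cases <;> cases j using Fin.cases
    · exact absurd rfl hij
    · simpa [twistGen] using e_orth (Fin.succ_ne_zero _).symm
    · simpa [twistGen] using e_orth (Fin.succ_ne_zero _)
    · have hne := fun hij' => hij (congrArg Fin.succ (π.injective (Fin.succ_injective _ hij')))
      simpa [twistGen] using e_orth hne
  | esum =>
    rw [map_sum, map_one, ← e_sum, Fin.sum_univ_succ, Fin.sum_univ_succ]
    simp [twistGen, Equiv.sum_comp π fun j => eH k B n j.succ]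
  | aL i => simp [twistGen, ← mul_assoc, (h i).e_mul_left]
  | aR i => simp [twistGen, mul_assoc, a_mul_e]
  | asL i => simp [twistGen, ← mul_assoc, e_mul_as]
  | asR i => simp [twistGen, mul_assoc, (h i).right_mul_e]
  | bL i z => simp [twistGen, ← mul_assoc, (h i).e_mul_left]
  | bR i z => simp [twistGen, mul_assoc, (h i).right_mul_e]
  | badd i z w => simp [twistGen, b_add, mul_add, add_mul]
  | bmul i z w =>
    have hvu (c : HAlg k B n) : v i * (u i * c) = eH k B n 0 * c := by
      rw [← mul_assoc, (h i).mul_eq']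
    simp [twistGen, b_mul, mul_assoc, hvu]
  | bone i => simp [twistGen, (h i).left_mul_e, (h i).mul_eq]
  | bsmul i c z => simp [twistGen, b_smul]

lemma exists_isTwist (π : Equiv.Perm (Fin n)) {u v : Fin n → HAlg k B n}
    (h : ∀ i, IsInvPair (u i) (v i)) : ∃ φ, IsTwist φ π u v := by
  refine ⟨RingQuot.liftAlgHom k ⟨FreeAlgebra.lift k (twistGen π u v), twistGen_rel h⟩, h,
    ?_, ?_, ?_, ?_, ?_⟩ <;>
  simp [eH, aH, asH, bH, twistGen]

/-! ### Crisp–Paris endomorphisms -/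

/-- The twisting automorphisms of the Crisp–Paris endomorphism exchanging the copies `p`, `q`. -/
noncomputable def cpTwist (p q : Fin n) (x y : Bˣ) (i : Fin n) : HAlg k B n :=
  if i = p then bH k B n p x else if i = q then bH k B n p y else eH k B n 0

lemma isInvPair_cpTwist (p q : Fin n) (x y : Bˣ) (i : Fin n) :
    IsInvPair (cpTwist (k := k) p q x y i) (cpTwist p q x⁻¹ y⁻¹ i) := by
  unfold cpTwist
  split_ifs
  exacts [.b p x, .b p y, .e]

/-- The Crisp–Paris endomorphism exchanging the copies `p` and `q` of `Â`. -/
noncomputable def cpHom (p q : Fin n) (x y : Bˣ) : HAlg k B n →ₐ[k] HAlg k B n :=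
  (exists_isTwist (Equiv.swap p q) (isInvPair_cpTwist p q x y)).choose

lemma isTwist_cpHom (p q : Fin n) (x y : Bˣ) :
    IsTwist (cpHom (k := k) p q x y) (Equiv.swap p q) (cpTwist p q x y) (cpTwist p q x⁻¹ y⁻¹) :=
  (exists_isTwist (Equiv.swap p q) (isInvPair_cpTwist p q x y)).choose_spec

@[simp]
lemma cpHom_e_zero (p q : Fin n) (x y : Bˣ) :
    cpHom (k := k) p q x y (eH k B n 0) = eH k B n 0 :=
  (isTwist_cpHom p q x y).map_e_zero

@[simp]
lemma cpTwist_left (p q : Fin n) (x y : Bˣ) : cpTwist (k := k) p q x y p = bH k B n p x :=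
  if_pos rfl

lemma cpTwist_right {p q : Fin n} (h : p ≠ q) (x y : Bˣ) :
    cpTwist (k := k) p q x y q = bH k B n p y := by
  rw [cpTwist, if_neg h.symm, if_pos rfl]

lemma cpTwist_of_ne {p q i : Fin n} (hp : i ≠ p) (hq : i ≠ q) (x y : Bˣ) :
    cpTwist (k := k) p q x y i = eH k B n 0 := by
  rw [cpTwist, if_neg hp, if_neg hq]

@[simp]
lemma cpHom_b_left (p q : Fin n) (x y : Bˣ) (z : B) : cpHom (k := k) p q x y (bH k B n p z) =
    bH k B n p x * bH k B n q z * bH k B n p ((x⁻¹ : Bˣ) : B) := by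
  rw [(isTwist_cpHom p q x y).map_b, cpTwist_left, cpTwist_left, Equiv.swap_apply_left]

lemma cpHom_b_right {p q : Fin n} (h : p ≠ q) (x y : Bˣ) (z : B) :
    cpHom (k := k) p q x y (bH k B n q z) =
      bH k B n p y * bH k B n p z * bH k B n p ((y⁻¹ : Bˣ) : B) := by
  rw [(isTwist_cpHom p q x y).map_b, cpTwist_right h, cpTwist_right h, Equiv.swap_apply_right]

lemma cpHom_b_of_ne {p q i : Fin n} (hp : i ≠ p) (hq : i ≠ q) (x y : Bˣ) (z : B) :
    cpHom (k := k) p q x y (bH k B n i z) = bH k B n i z := by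
  rw [(isTwist_cpHom p q x y).map_b, cpTwist_of_ne hp hq, cpTwist_of_ne hp hq,
    Equiv.swap_apply_of_ne_of_ne hp hq, e_mul_b, b_mul_e]

lemma isCPAt_cpHom (x y : Bˣ) (i : Fin (n - 1)) :
    IsCPAt k B x y n i (cpHom (lo i) (hi i) x y) := by
  have hne : lo i ≠ hi i := by simp [lo, hi, Fin.ext_iff]
  have h := isTwist_cpHom (k := k) (lo i) (hi i) x y
  refine ⟨h.map_e_zero, ?_, ?_, fun j hp hq => ?_, ?_, ?_, cpHom_b_left _ _ _ _, ?_, ?_,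
    cpHom_b_right hne _ _, fun j hp hq => ⟨?_, ?_, cpHom_b_of_ne hp hq _ _⟩⟩
  · rw [h.map_e, Equiv.swap_apply_left]
  · rw [h.map_e, Equiv.swap_apply_right]
  · rw [h.map_e, Equiv.swap_apply_of_ne_of_ne hp hq]
  · rw [h.map_a, Equiv.swap_apply_left, cpTwist_left]
  · rw [h.map_as, Equiv.swap_apply_left, cpTwist_left]
  · rw [h.map_a, Equiv.swap_apply_right, cpTwist_right hne]
  · rw [h.map_as, Equiv.swap_apply_right, cpTwist_right hne]
  · rw [h.map_a, Equiv.swap_apply_of_ne_of_ne hp hq, cpTwist_of_ne hp hq, e_mul_a]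
  · rw [h.map_as, Equiv.swap_apply_of_ne_of_ne hp hq, cpTwist_of_ne hp hq, as_mul_e]

lemma cpHom_comp_inv {p q : Fin n} (hpq : p ≠ q) {x y : Bˣ} (hxy : Commute x y) :
    (cpHom (k := k) p q x y).comp (cpHom q p x⁻¹ y⁻¹) = AlgHom.id k _ := by
  refine ((isTwist_cpHom p q x y).comp (isTwist_cpHom q p x⁻¹ y⁻¹)).ext .id (fun i => ?_)
    (fun i => ?_)
  · simp [Equiv.swap_comm q p]
  · have hxy' : ((x⁻¹ : Bˣ) : B) * y = y * ((x⁻¹ : Bˣ) : B) := by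
      simpa using congrArg Units.val hxy.inv_left.eq
    by_cases hp : i = p
    · subst hp
      simp [cpTwist_right hpq.symm, cpTwist_right hpq, cpHom_b_right hpq]
    by_cases hq : i = q
    · subst hq
      simp [cpHom_b_right hpq, mul_assoc, b_conj _ x⁻¹ y hxy']
    simp [Equiv.swap_apply_of_ne_of_ne hq hp, cpTwist_of_ne hp hq, cpTwist_of_ne hq hp, e_idem]

/-- The Crisp–Paris automorphism exchanging the copies `p` and `q` of `Â`. -/
noncomputable def cpEquiv {p q : Fin n} (hpq : p ≠ q) {x y : Bˣ} (hxy : Commute x y) :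
    HAlg k B n ≃ₐ[k] HAlg k B n :=
  AlgEquiv.ofAlgHom (cpHom p q x y) (cpHom q p x⁻¹ y⁻¹) (cpHom_comp_inv hpq hxy) <| by
    simpa using cpHom_comp_inv (k := k) hpq.symm hxy.inv_inv

lemma cpHom_braid {p q r : Fin n} (hpq : p ≠ q) (hqr : q ≠ r) (hpr : p ≠ r) {x y : Bˣ}
    (hxy : Commute x y) :
    (cpHom (k := k) p q x y).comp ((cpHom q r x y).comp (cpHom p q x y)) =
      (cpHom q r x y).comp ((cpHom p q x y).comp (cpHom q r x y)) := by
  have hσ := isTwist_cpHom (k := k) p q x y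
  have hτ := isTwist_cpHom (k := k) q r x y
  have hxy' : (x : B) * y = y * x := by simpa using congrArg Units.val hxy.eq
  refine (hσ.comp (hτ.comp hσ)).ext (hτ.comp (hσ.comp hτ)) (fun i => ?_) (fun i => ?_)
  · by_cases hp : i = p
    · subst hp
      simp [Equiv.swap_apply_of_ne_of_ne, *, Ne.symm]
    by_cases hq : i = q
    · subst hq
      simp [Equiv.swap_apply_of_ne_of_ne, *, Ne.symm]
    by_cases hr : i = r
    · subst hr
      simp [Equiv.swap_apply_of_ne_of_ne, *, Ne.symm]
    simp [Equiv.swap_apply_of_ne_of_ne, *]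
  · by_cases hp : i = p
    · subst hp
      simp [Equiv.swap_apply_of_ne_of_ne, *, hqr.symm, hpr.symm, mul_assoc, cpTwist_of_ne,
        cpHom_b_right, cpHom_b_of_ne, b_conj]
    by_cases hq : i = q
    · subst hq
      simp [Equiv.swap_apply_of_ne_of_ne, *, hpq.symm, hqr.symm, hpr.symm, mul_assoc,
        cpTwist_of_ne, cpTwist_right, cpHom_b_right, cpHom_b_of_ne, b_conj]
    by_cases hr : i = r
    · subst hr
      simp [Equiv.swap_apply_of_ne_of_ne, *, hpq.symm, hqr.symm, hpr.symm, mul_assoc,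
        cpTwist_of_ne, cpTwist_right, cpHom_b_right, cpHom_b_of_ne]
    simp [Equiv.swap_apply_of_ne_of_ne, *, cpTwist_of_ne]

lemma cpHom_comm {p q r s : Fin n} (hpq : p ≠ q) (hrs : r ≠ s) (hpr : p ≠ r) (hps : p ≠ s)
    (hqr : q ≠ r) (hqs : q ≠ s) (x y : Bˣ) :
    (cpHom (k := k) p q x y).comp (cpHom r s x y) = (cpHom r s x y).comp (cpHom p q x y) := by
  have hσ := isTwist_cpHom (k := k) p q x y
  have hτ := isTwist_cpHom (k := k) r s x y
  refine (hσ.comp hτ).ext (hτ.comp hσ) (fun i => ?_) (fun i => ?_)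
  · exact DFunLike.congr_fun (Equiv.Perm.disjoint_swap_swap (by simp [*])).commute.eq i
  · by_cases hp : i = p
    · subst hp
      simp [Equiv.swap_apply_of_ne_of_ne, *, cpTwist_of_ne, cpHom_b_of_ne]
    by_cases hq : i = q
    · subst hq
      simp [Equiv.swap_apply_of_ne_of_ne, *, Ne.symm, cpTwist_of_ne, cpTwist_right, cpHom_b_of_ne]
    by_cases hr : i = r
    · subst hr
      simp [Equiv.swap_apply_of_ne_of_ne, *, Ne.symm, cpTwist_of_ne, cpHom_b_of_ne]
    by_cases hs : i = s
    · subst hs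
      simp [Equiv.swap_apply_of_ne_of_ne, *, Ne.symm, cpTwist_of_ne, cpTwist_right, cpHom_b_of_ne]
    simp [Equiv.swap_apply_of_ne_of_ne, *, cpTwist_of_ne]

end HAlg

theorem statement14 (x y : Bˣ) (hcomm : (x : B) * (y : B) = (y : B) * (x : B)) (n : ℕ) :
    ∃ σ : Fin (n - 1) → (HAlg k B n ≃ₐ[k] HAlg k B n),
      -- the defining assignments (well-defined invertible k-linear endofunctors)
      (∀ i : Fin (n - 1), IsCPAt k B x y n i (σ i)) ∧
      -- the braid relations
      (∀ i j : Fin (n - 1), (i : ℕ) + 1 = (j : ℕ) →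
        ∀ z, σ i (σ j (σ i z)) = σ j (σ i (σ j z))) ∧
      (∀ i j : Fin (n - 1), (i : ℕ) + 2 ≤ (j : ℕ) →
        ∀ z, σ i (σ j z) = σ j (σ i z)) ∧
      -- hence a left action of B_n on Â^{(n)}
      ∃ ρ : BraidGroup n →* (HAlg k B n ≃ₐ[k] HAlg k B n),
        ∀ i : Fin (n - 1), ρ (braidGen i) = σ i := by
  have hxy : Commute x y := Units.ext hcomm
  have hlh (i : Fin (n - 1)) : lo i ≠ hi i := by simp [lo, hi, Fin.ext_iff]
  let σ (i : Fin (n - 1)) : HAlg k B n ≃ₐ[k] HAlg k B n := HAlg.cpEquiv (hlh i) hxy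
  have hbraid (i j : Fin (n - 1)) (hij : (i : ℕ) + 1 = j) (z : HAlg k B n) :
      σ i (σ j (σ i z)) = σ j (σ i (σ j z)) := by
    have hi_eq : hi i = lo j := Fin.ext hij
    have h := HAlg.cpHom_braid (k := k) (hlh i) (hi_eq ▸ hlh j) (r := hi j)
      (by simp [lo, hi, Fin.ext_iff]; omega) hxy
    rw [hi_eq] at h
    have h' := DFunLike.congr_fun h z
    simp only [AlgHom.comp_apply] at h'
    simp only [σ, HAlg.cpEquiv, AlgEquiv.ofAlgHom_apply, hi_eq]
    exact h'
  have hfar (i j : Fin (n - 1)) (hij : (i : ℕ) + 2 ≤ j) (z : HAlg k B n) :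
      σ i (σ j z) = σ j (σ i z) := by
    refine DFunLike.congr_fun (HAlg.cpHom_comm (hlh i) (hlh j) ?_ ?_ ?_ ?_ x y) z <;>
    simp [lo, hi, Fin.ext_iff] <;> omega
  refine ⟨σ, fun i => HAlg.isCPAt_cpHom x y i, hbraid, hfar, PresentedGroup.toGroup (f := σ) ?_,
    fun i => PresentedGroup.toGroup.of _⟩
  rintro r (⟨i, j, hij, rfl⟩ | ⟨i, j, hij, rfl⟩)
  · simp only [map_mul, map_inv, FreeGroup.lift_apply_of]
    exact mul_inv_eq_one.mpr (AlgEquiv.ext (hbraid i j hij))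
  · simp only [map_mul, map_inv, FreeGroup.lift_apply_of]
    exact mul_inv_eq_one.mpr (mul_inv_eq_iff_eq_mul.mpr (AlgEquiv.ext (hfar i j hij)))
end

section
/- Let B be a unital associative k-algebra and x, y ∈ B invertible commuting elements, and let I be any two-sided ideal of the endomorphism algebra Â(0,0) (the k-algebra generated by B together with the composite aa^*). For f ∈ I write f_i for the image of f in End(0) of Â^{(n)} under the i-th coproduct inclusion Â → Â^{(n)}. Then the Crisp–Paris-type B_n-action on Â^{(n)} preserves the two-sided ideal generated by f_1,…,f_n for all f ∈ I; indeed σ_k(f_k) = x_k f_{k+1} x_k^{-1}, σ_k(f_{k+1}) = y_k f_k y_k^{-1}, and σ_k(f_i) = f_i for i ≠ k, k+1. Consequently the B_n-action descends to a left action of B_n on the quotient k-category (Â/I)^{(n)} := Â^{(n)}/⟨I_1 ∪ ⋯ ∪ I_n⟩ by k-linear automorphisms. -/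
variable (k B : Type) [CommRing k] [Ring B] [Algebra k B]

/-- The `i`-th coproduct inclusion `Â → Â^{(n)}` (a morphism of pointed
`k`-categories, i.e. a non-unital algebra homomorphism sending object `1` to
object `i` and the generators of the `i`-th copy accordingly). -/
def IsIncl (n : ℕ) (i : Fin n) (f : HAlg k B 1 →ₙₐ[k] HAlg k B n) : Prop :=
  f (eH k B 1 0) = eH k B n 0 ∧
  f (eH k B 1 1) = eH k B n i.succ ∧
  f (aH k B 1 0) = aH k B n i ∧
  f (asH k B 1 0) = asH k B n i ∧
  ∀ z : B, f (bH k B 1 0 z) = bH k B n i z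

section Relations

variable {k B}
variable {n : ℕ}

theorem eH_mul_self (i : Fin (n + 1)) : eH k B n i * eH k B n i = eH k B n i := by
  simpa [eH] using RingQuot.mkAlgHom_rel k (HRel.idem (k := k) (B := B) i)

theorem eH_mul_of_ne {i j : Fin (n + 1)} (h : i ≠ j) : eH k B n i * eH k B n j = 0 := by
  simpa [eH] using RingQuot.mkAlgHom_rel k (HRel.orth (k := k) (B := B) i j h)

theorem sum_eH : ∑ i : Fin (n + 1), eH k B n i = 1 := by
  simpa [eH] using RingQuot.mkAlgHom_rel k (HRel.esum (k := k) (B := B) (n := n))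

theorem eH_zero_mul_aH (i : Fin n) : eH k B n 0 * aH k B n i = aH k B n i := by
  simpa [eH, aH] using RingQuot.mkAlgHom_rel k (HRel.aL (k := k) (B := B) i)

theorem aH_mul_eH_succ (i : Fin n) : aH k B n i * eH k B n i.succ = aH k B n i := by
  simpa [eH, aH] using RingQuot.mkAlgHom_rel k (HRel.aR (k := k) (B := B) i)

theorem eH_succ_mul_asH (i : Fin n) : eH k B n i.succ * asH k B n i = asH k B n i := by
  simpa [eH, asH] using RingQuot.mkAlgHom_rel k (HRel.asL (k := k) (B := B) i)

theorem asH_mul_eH_zero (i : Fin n) : asH k B n i * eH k B n 0 = asH k B n i := by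
  simpa [eH, asH] using RingQuot.mkAlgHom_rel k (HRel.asR (k := k) (B := B) i)

theorem eH_zero_mul_bH (i : Fin n) (z : B) : eH k B n 0 * bH k B n i z = bH k B n i z := by
  simpa [eH, bH] using RingQuot.mkAlgHom_rel k (HRel.bL (k := k) (B := B) i z)

theorem bH_mul_eH_zero (i : Fin n) (z : B) : bH k B n i z * eH k B n 0 = bH k B n i z := by
  simpa [eH, bH] using RingQuot.mkAlgHom_rel k (HRel.bR (k := k) (B := B) i z)

theorem bH_mul (i : Fin n) (z w : B) : bH k B n i z * bH k B n i w = bH k B n i (z * w) := by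
  simpa [bH] using (RingQuot.mkAlgHom_rel k (HRel.bmul (k := k) (B := B) i z w)).symm

theorem bH_one (i : Fin n) : bH k B n i 1 = eH k B n 0 := by
  simpa [eH, bH] using RingQuot.mkAlgHom_rel k (HRel.bone (k := k) (B := B) i)

theorem aH_mul_eH_zero (i : Fin n) : aH k B n i * eH k B n 0 = 0 := by
  rw [← aH_mul_eH_succ, mul_assoc, eH_mul_of_ne (Fin.succ_ne_zero i), mul_zero]

theorem eH_zero_mul_asH (i : Fin n) : eH k B n 0 * asH k B n i = 0 := by
  rw [← eH_succ_mul_asH, ← mul_assoc, eH_mul_of_ne (Fin.succ_ne_zero i).symm, zero_mul]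

theorem bH_mul_eH_succ (i j : Fin n) (z : B) : bH k B n i z * eH k B n j.succ = 0 := by
  rw [← bH_mul_eH_zero, mul_assoc, eH_mul_of_ne (Fin.succ_ne_zero j).symm, mul_zero]

theorem eH_succ_mul_bH (i j : Fin n) (z : B) : eH k B n j.succ * bH k B n i z = 0 := by
  rw [← eH_zero_mul_bH, ← mul_assoc, eH_mul_of_ne (Fin.succ_ne_zero j), zero_mul]

theorem bH_mul_asH (i j : Fin n) (z : B) : bH k B n i z * asH k B n j = 0 := by
  rw [← eH_succ_mul_asH, ← mul_assoc, bH_mul_eH_succ, zero_mul]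

theorem aH_mul_bH (i j : Fin n) (z : B) : aH k B n j * bH k B n i z = 0 := by
  rw [← aH_mul_eH_succ, mul_assoc, eH_succ_mul_bH, mul_zero]

theorem bH_units_mul_inv (i : Fin n) (u : Bˣ) :
    bH k B n i (u : B) * bH k B n i ((u⁻¹ : Bˣ) : B) = eH k B n 0 := by
  rw [bH_mul, Units.mul_inv, bH_one]

theorem bH_units_inv_mul (i : Fin n) (u : Bˣ) :
    bH k B n i ((u⁻¹ : Bˣ) : B) * bH k B n i (u : B) = eH k B n 0 := by
  rw [bH_mul, Units.inv_mul, bH_one]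

end Relations

section Ext

variable {k B}
variable {n : ℕ}

/-- `Â^{(n)}` is generated, already as a non-unital algebra, by its standard generators. -/
theorem hAlg_induction {P : HAlg k B n → Prop}
    (he : ∀ i, P (eH k B n i)) (ha : ∀ i, P (aH k B n i)) (has : ∀ i, P (asH k B n i))
    (hb : ∀ i z, P (bH k B n i z)) (hsmul : ∀ (c : k) u, P u → P (c • u))
    (hadd : ∀ u v, P u → P v → P (u + v)) (hmul : ∀ u v, P u → P v → P (u * v))
    (u : HAlg k B n) : P u := by
  obtain ⟨w, rfl⟩ := RingQuot.mkAlgHom_surjective k (HRel k B n) u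
  have h_zero : P 0 := by simpa using hsmul 0 _ (he 0)
  have h_one : P 1 := by
    rw [← sum_eH]
    exact Finset.sum_induction _ P hadd h_zero fun i _ => he i
  induction w using FreeAlgebra.induction with
  | grade0 c => rw [AlgHom.commutes, Algebra.algebraMap_eq_smul_one]; exact hsmul c 1 h_one
  | grade1 g =>
    cases g with
    | e i => exact he i
    | a i => exact ha i
    | as i => exact has i
    | b i z => exact hb i z
  | mul u v hu hv => rw [map_mul]; exact hmul _ _ hu hv
  | add u v hu hv => rw [map_add]; exact hadd _ _ hu hv

/-- Algebra automorphisms of `Â^{(n)}` agreeing on the standard generators are equal. -/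
theorem hAlg_equiv_ext {σ τ : HAlg k B n ≃ₐ[k] HAlg k B n}
    (he₀ : σ (eH k B n 0) = τ (eH k B n 0))
    (h : ∀ (i : Fin n) (z : B), σ (eH k B n i.succ) = τ (eH k B n i.succ) ∧
      σ (aH k B n i) = τ (aH k B n i) ∧ σ (asH k B n i) = τ (asH k B n i) ∧
      σ (bH k B n i z) = τ (bH k B n i z)) : σ = τ := by
  ext u
  induction u using hAlg_induction with
  | he i => exact Fin.cases he₀ (fun i => (h i 0).1) i
  | ha i => exact (h i 0).2.1
  | has i => exact (h i 0).2.2.1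
  | hb i z => exact (h i z).2.2.2
  | hsmul c u hu => rw [map_smul, map_smul, hu]
  | hadd u v hu hv => rw [map_add, map_add, hu, hv]
  | hmul u v hu hv => rw [map_mul, map_mul, hu, hv]

/-- If a homomorphism out of `Â` agrees on generators with the `j`-th inclusion twisted by an
invertible element `u` of the `l`-th copy of `B`, then on the corner `Â(0,0)` it is the `j`-th
inclusion conjugated by `u_l`. -/
theorem apply_corner_eq_conj {φ ψ : HAlg k B 1 →ₙₐ[k] HAlg k B n} {j l : Fin n} (u : Bˣ)
    (hψ : IsIncl k B n j ψ)
    (he₀ : φ (eH k B 1 0) = eH k B n 0) (he₁ : φ (eH k B 1 1) = eH k B n j.succ)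
    (ha : φ (aH k B 1 0) = bH k B n l u * aH k B n j)
    (has : φ (asH k B 1 0) = asH k B n j * bH k B n l ((u⁻¹ : Bˣ) : B))
    (hb : ∀ z, φ (bH k B 1 0 z) =
      bH k B n l u * bH k B n j z * bH k B n l ((u⁻¹ : Bˣ) : B))
    {f : HAlg k B 1} (hf : eH k B 1 0 * f * eH k B 1 0 = f) :
    φ f = bH k B n l u * ψ f * bH k B n l ((u⁻¹ : Bˣ) : B) := by
  obtain ⟨hψe₀, hψe₁, hψa, hψas, hψb⟩ := hψ
  set v : HAlg k B n := bH k B n l u + (1 - eH k B n 0) with hv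
  set v' : HAlg k B n := bH k B n l ((u⁻¹ : Bˣ) : B) + (1 - eH k B n 0) with hv'
  have hv'v : v' * v = 1 := by
    simp [hv, hv', mul_add, add_mul, mul_sub, sub_mul, bH_units_inv_mul, bH_mul_eH_zero,
      eH_zero_mul_bH, eH_mul_self]
  have key : ∀ g, φ g = v * ψ g * v' := by
    intro g
    induction g using hAlg_induction with
    | he i =>
      fin_cases i
      · simp [he₀, hψe₀, hv, hv', mul_add, add_mul, mul_sub, sub_mul, bH_units_mul_inv,
          bH_mul_eH_zero, eH_mul_self]
      · simp [he₁, hψe₁, hv, hv', mul_add, add_mul, mul_sub, sub_mul, bH_mul_eH_succ,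
          eH_succ_mul_bH, eH_mul_of_ne (Fin.succ_ne_zero j),
          eH_mul_of_ne (Fin.succ_ne_zero j).symm]
    | ha i =>
      rw [Subsingleton.elim i 0]
      simp [ha, hψa, hv, hv', mul_add, add_mul, mul_sub, sub_mul, mul_assoc, aH_mul_bH,
        aH_mul_eH_zero, eH_zero_mul_aH]
    | has i =>
      rw [Subsingleton.elim i 0]
      simp [has, hψas, hv, hv', mul_add, add_mul, mul_sub, sub_mul, bH_mul_asH,
        asH_mul_eH_zero, eH_zero_mul_asH]
    | hb i z =>
      rw [Subsingleton.elim i 0]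
      simp [hb, hψb, hv, hv', mul_add, add_mul, mul_sub, sub_mul, mul_assoc, bH_mul_eH_zero,
        eH_zero_mul_bH]
    | hsmul c g hg => rw [map_smul, map_smul, hg, mul_smul_comm, smul_mul_assoc]
    | hadd g h hg hh => rw [map_add, map_add, hg, hh, mul_add v, add_mul _ _ v']
    | hmul g h hg hh =>
      rw [map_mul, map_mul, hg, hh]
      calc v * ψ g * v' * (v * ψ h * v') = v * ψ g * (v' * v) * ψ h * v' := by
            simp only [mul_assoc]
        _ = v * (ψ g * ψ h) * v' := by rw [hv'v]; simp only [mul_one, mul_assoc]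
  have hvl : v * eH k B n 0 = bH k B n l u := by
    simp [hv, add_mul, sub_mul, bH_mul_eH_zero, eH_mul_self]
  have hvr : eH k B n 0 * v' = bH k B n l ((u⁻¹ : Bˣ) : B) := by
    simp [hv', mul_add, mul_sub, eH_zero_mul_bH, eH_mul_self]
  have hψf : eH k B n 0 * ψ f * eH k B n 0 = ψ f := by
    rw [← hψe₀, ← map_mul, ← map_mul, hf]
  rw [key f, ← hψf, ← hvl, ← hvr]
  simp only [mul_assoc, ← mul_assoc (eH k B n 0) (eH k B n 0), eH_mul_self]

end Ext

section Action

variable {k B}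
variable {n : ℕ} {x y : Bˣ} {ι : Fin n → (HAlg k B 1 →ₙₐ[k] HAlg k B n)}

theorem IsCPAt.apply_incl_lo {K : Fin (n - 1)} {σ : HAlg k B n ≃ₐ[k] HAlg k B n}
    (hσ : IsCPAt k B x y n K σ) (hι : ∀ i, IsIncl k B n i (ι i))
    {f : HAlg k B 1} (hf : eH k B 1 0 * f * eH k B 1 0 = f) :
    σ (ι (lo K) f) =
      bH k B n (lo K) (x : B) * ι (hi K) f * bH k B n (lo K) ((x⁻¹ : Bˣ) : B) := by
  obtain ⟨h0, h1, h2, h3, h4, h5, h6, h7, h8, h9, h10⟩ := hσ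
  obtain ⟨g0, g1, g2, g3, g4⟩ := hι (lo K)
  refine apply_corner_eq_conj (φ := (σ : HAlg k B n →ₙₐ[k] HAlg k B n).comp (ι (lo K))) x
    (hι (hi K)) ((congrArg σ g0).trans h0) ((congrArg σ g1).trans h1)
    ((congrArg σ g2).trans h4) ((congrArg σ g3).trans h5)
    (fun z => (congrArg σ (g4 z)).trans (h6 z)) hf

theorem IsCPAt.apply_incl_hi {K : Fin (n - 1)} {σ : HAlg k B n ≃ₐ[k] HAlg k B n}
    (hσ : IsCPAt k B x y n K σ) (hι : ∀ i, IsIncl k B n i (ι i))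
    {f : HAlg k B 1} (hf : eH k B 1 0 * f * eH k B 1 0 = f) :
    σ (ι (hi K) f) =
      bH k B n (lo K) (y : B) * ι (lo K) f * bH k B n (lo K) ((y⁻¹ : Bˣ) : B) := by
  obtain ⟨h0, h1, h2, h3, h4, h5, h6, h7, h8, h9, h10⟩ := hσ
  obtain ⟨g0, g1, g2, g3, g4⟩ := hι (hi K)
  refine apply_corner_eq_conj (φ := (σ : HAlg k B n →ₙₐ[k] HAlg k B n).comp (ι (hi K))) y
    (hι (lo K)) ((congrArg σ g0).trans h0) ((congrArg σ g1).trans h2)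
    ((congrArg σ g2).trans h7) ((congrArg σ g3).trans h8)
    (fun z => (congrArg σ (g4 z)).trans (h9 z)) hf

theorem IsCPAt.apply_incl_of_ne {K : Fin (n - 1)} {σ : HAlg k B n ≃ₐ[k] HAlg k B n}
    (hσ : IsCPAt k B x y n K σ) (hι : ∀ i, IsIncl k B n i (ι i)) {i : Fin n}
    (hlo : i ≠ lo K) (hhi : i ≠ hi K) (f : HAlg k B 1) :
    σ (ι i f) = ι i f := by
  obtain ⟨h0, h1, h2, h3, h4, h5, h6, h7, h8, h9, h10⟩ := hσ
  obtain ⟨g0, g1, g2, g3, g4⟩ := hι i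
  obtain ⟨j0, j1, j2⟩ := h10 i hlo hhi
  induction f using hAlg_induction with
  | he l =>
    fin_cases l
    · simp [g0, h0]
    · simp [g1, h3 i hlo hhi]
  | ha l => rw [Subsingleton.elim l 0, g2, j0]
  | has l => rw [Subsingleton.elim l 0, g3, j1]
  | hb l z => rw [Subsingleton.elim l 0, g4, j2]
  | hsmul c u hu => rw [map_smul, map_smul, hu]
  | hadd u v hu hv => rw [map_add, map_add, hu, hv]
  | hmul u v hu hv => rw [map_mul, map_mul, hu, hv]

/-- Automorphisms attached to distant strands commute. -/
theorem IsCPAt.comm {i j : Fin (n - 1)} (hij : (i : ℕ) + 2 ≤ j)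
    {σ τ : HAlg k B n ≃ₐ[k] HAlg k B n}
    (hσ : IsCPAt k B x y n i σ) (hτ : IsCPAt k B x y n j τ) : σ * τ = τ * σ := by
  have n1 : lo i ≠ lo j := by simp [lo, Fin.ext_iff]; omega
  have n2 : lo i ≠ hi j := by simp [lo, hi, Fin.ext_iff]; omega
  have n3 : hi i ≠ lo j := by simp [lo, hi, Fin.ext_iff]; omega
  have n4 : hi i ≠ hi j := by simp [hi, Fin.ext_iff]; omega
  obtain ⟨h0, h1, h2, h3, h4, h5, h6, h7, h8, h9, h10⟩ := hσ
  obtain ⟨g0, g1, g2, g3, g4, g5, g6, g7, g8, g9, g10⟩ := hτ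
  refine hAlg_equiv_ext (by simp [h0, g0]) fun l z => ?_
  obtain ⟨a1, a2, a3⟩ := h10 _ n1.symm n3.symm
  obtain ⟨b1, b2, b3⟩ := h10 _ n2.symm n4.symm
  obtain ⟨c1, c2, c3⟩ := g10 _ n1 n2
  obtain ⟨d1, d2, d3⟩ := g10 _ n3 n4
  have e1 := h3 _ n1.symm n3.symm
  have e2 := h3 _ n2.symm n4.symm
  have e3 := g3 _ n1 n2
  have e4 := g3 _ n3 n4
  by_cases l1 : l = lo i
  · subst l1; simp [*]
  by_cases l2 : l = hi i
  · subst l2; simp [*]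
  by_cases l3 : l = lo j
  · subst l3; simp [*]
  by_cases l4 : l = hi j
  · subst l4; simp [*]
  obtain ⟨s1, s2, s3⟩ := h10 l l1 l2
  obtain ⟨t1, t2, t3⟩ := g10 l l3 l4
  simp [h3 l l1 l2, g3 l l3 l4, *]

/-- Automorphisms attached to adjacent strands satisfy the braid relation. -/
theorem IsCPAt.braid (hcomm : (x : B) * (y : B) = (y : B) * (x : B))
    {i j : Fin (n - 1)} (hij : (i : ℕ) + 1 = j)
    {σ τ : HAlg k B n ≃ₐ[k] HAlg k B n}
    (hσ : IsCPAt k B x y n i σ) (hτ : IsCPAt k B x y n j τ) :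
    σ * τ * σ = τ * σ * τ := by
  have hxy : Commute x y := Units.ext hcomm
  have n1 : lo j = hi i := by simp [lo, hi, hij]
  have n2 : lo i ≠ hi j := by simp [lo, hi, Fin.ext_iff]; omega
  have n3 : lo i ≠ lo j := by simp [lo, Fin.ext_iff]; omega
  have n4 : hi j ≠ hi i := by simp [hi, Fin.ext_iff]; omega
  obtain ⟨h0, h1, h2, h3, h4, h5, h6, h7, h8, h9, h10⟩ := hσ
  obtain ⟨g0, g1, g2, g3, g4, g5, g6, g7, g8, g9, g10⟩ := hτ
  obtain ⟨b1, b2, b3⟩ := h10 _ n2.symm n4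
  obtain ⟨c1, c2, c3⟩ := g10 _ n3 n2
  have e2 := h3 _ n2.symm n4
  have e3 := g3 _ n3 n2
  rw [n1] at g1 g2 g4 g5 g6 g7 g8 g9
  have fix : ∀ u : Bˣ, Commute u y →
      σ (bH k B n (hi i) (u : B)) = bH k B n (lo i) (u : B) := by
    intro u hu
    rw [h9, bH_mul, bH_mul, ← Units.val_mul, ← Units.val_mul, ← hu.eq, mul_inv_cancel_right]
  have fx := fix x hxy
  have fx' := fix x⁻¹ hxy.inv_left
  have fy := fix y (Commute.refl y)
  have fy' := fix y⁻¹ (Commute.refl y).inv_left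
  have cancel : ∀ (u : Bˣ) (l : Fin n) (t : HAlg k B n),
      bH k B n l ((u⁻¹ : Bˣ) : B) * (bH k B n l (u : B) * t) = eH k B n 0 * t := by
    intro u l t
    rw [← mul_assoc, bH_units_inv_mul]
  have eb : ∀ (l : Fin n) (z : B) (t : HAlg k B n),
      eH k B n 0 * (bH k B n l z * t) = bH k B n l z * t := by
    intro l z t
    rw [← mul_assoc, eH_zero_mul_bH]
  refine hAlg_equiv_ext (by simp [h0, g0]) fun l z => ?_
  by_cases hl : l = lo i ∨ l = hi i ∨ l = hi j
  · rcases hl with rfl | rfl | rfl <;> refine ⟨?_, ?_, ?_, ?_⟩ <;>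
      simp only [AlgEquiv.mul_apply, map_mul, mul_assoc, h1, h2, h4, h5, h6, h7, h8, h9 z, g1,
        g2, g4, g5, g6, g7, g8, g9, b1, b2, b3, c1, c2, c3, e2, e3, fx, fx', fy, fy', cancel,
        eb, eH_zero_mul_aH]
  obtain ⟨l1, l2, l3⟩ : l ≠ lo i ∧ l ≠ hi i ∧ l ≠ hi j := by simpa using hl
  have l4 : l ≠ lo j := n1 ▸ l2
  obtain ⟨s1, s2, s3⟩ := h10 l l1 l2
  obtain ⟨t1, t2, t3⟩ := g10 l l4 l3
  simp [h3 l l1 l2, g3 l l4 l3, s1, s2, s3, t1, t2, t3]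

end Action

/-- An automorphism respecting a relation in both directions descends to the quotient. -/
theorem RingQuot.exists_algEquiv {k A : Type*} [CommRing k] [Ring A] [Algebra k A]
    {s : A → A → Prop} (σ : A ≃ₐ[k] A)
    (h : ∀ ⦃u v⦄, s u v → mkAlgHom k s (σ u) = mkAlgHom k s (σ v))
    (h' : ∀ ⦃u v⦄, s u v → mkAlgHom k s (σ.symm u) = mkAlgHom k s (σ.symm v)) :
    ∃ τ : RingQuot s ≃ₐ[k] RingQuot s, ∀ z, τ (mkAlgHom k s z) = mkAlgHom k s (σ z) := by
  let F : RingQuot s →ₐ[k] RingQuot s :=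
    liftAlgHom k ⟨(mkAlgHom k s).comp (σ : A →ₐ[k] A), h⟩
  let G : RingQuot s →ₐ[k] RingQuot s :=
    liftAlgHom k ⟨(mkAlgHom k s).comp (σ.symm : A →ₐ[k] A), h'⟩
  have hF : ∀ z, F (mkAlgHom k s z) = mkAlgHom k s (σ z) := fun z =>
    liftAlgHom_mkAlgHom_apply k _ _ z
  have hG : ∀ z, G (mkAlgHom k s z) = mkAlgHom k s (σ.symm z) := fun z =>
    liftAlgHom_mkAlgHom_apply k _ _ z
  refine ⟨AlgEquiv.ofAlgHom F G ?_ ?_, hF⟩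
  · ext z
    simp [hF, hG]
  · ext z
    simp [hF, hG]

theorem statement15 (x y : Bˣ) (hcomm : (x : B) * (y : B) = (y : B) * (x : B)) (n : ℕ)
    -- I is a two-sided ideal of the corner algebra Â(0,0) = e₀·Â·e₀
    (I : Set (HAlg k B 1))
    (hIcorner : ∀ f ∈ I, eH k B 1 0 * f * eH k B 1 0 = f)
    (hIadd : ∀ f ∈ I, ∀ g ∈ I, f + g ∈ I)
    (hIneg : ∀ f ∈ I, -f ∈ I)
    (hIl : ∀ f ∈ I, ∀ z : HAlg k B 1, (eH k B 1 0 * z * eH k B 1 0) * f ∈ I)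
    (hIr : ∀ f ∈ I, ∀ z : HAlg k B 1, f * (eH k B 1 0 * z * eH k B 1 0) ∈ I)
    -- the coproduct inclusions ι i : Â → Â^{(n)}, so that f_i = ι i f
    (ι : ∀ _ : Fin n, HAlg k B 1 →ₙₐ[k] HAlg k B n)
    (hι : ∀ i : Fin n, IsIncl k B n i (ι i))
    -- the Crisp–Paris-type B_n-action
    (σ : Fin (n - 1) → (HAlg k B n ≃ₐ[k] HAlg k B n))
    (hσ : ∀ i : Fin (n - 1), IsCPAt k B x y n i (σ i)) :
    -- σ_k(f_k) = x_k f_{k+1} x_k⁻¹, σ_k(f_{k+1}) = y_k f_k y_k⁻¹, σ_k(f_i) = f_i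
    (∀ (K : Fin (n - 1)), ∀ f ∈ I,
      σ K (ι (lo K) f) =
        bH k B n (lo K) (x : B) * ι (hi K) f * bH k B n (lo K) ((x⁻¹ : Bˣ) : B) ∧
      σ K (ι (hi K) f) =
        bH k B n (lo K) (y : B) * ι (lo K) f * bH k B n (lo K) ((y⁻¹ : Bˣ) : B) ∧
      ∀ i : Fin n, i ≠ lo K → i ≠ hi K → σ K (ι i f) = ι i f) ∧
    -- the action preserves the two-sided ideal generated by the f_i, i.e. the
    -- kernel of the projection onto the quotient (Â/I)^{(n)}
    (∀ (K : Fin (n - 1)) (z : HAlg k B n),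
      RingQuot.mkAlgHom k (fun u v : HAlg k B n =>
          (∃ (i : Fin n) (f : HAlg k B 1), f ∈ I ∧ u = ι i f) ∧ v = 0) z = 0 →
        RingQuot.mkAlgHom k (fun u v : HAlg k B n =>
          (∃ (i : Fin n) (f : HAlg k B 1), f ∈ I ∧ u = ι i f) ∧ v = 0) (σ K z) = 0 ∧
        RingQuot.mkAlgHom k (fun u v : HAlg k B n =>
          (∃ (i : Fin n) (f : HAlg k B 1), f ∈ I ∧ u = ι i f) ∧ v = 0) ((σ K).symm z) = 0) ∧
    -- consequently the action descends to a left B_n-action on the quotient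
    -- k-category (Â/I)^{(n)} by k-linear automorphisms
    (∃ σbar : Fin (n - 1) →
        (RingQuot (fun u v : HAlg k B n =>
            (∃ (i : Fin n) (f : HAlg k B 1), f ∈ I ∧ u = ι i f) ∧ v = 0) ≃ₐ[k]
          RingQuot (fun u v : HAlg k B n =>
            (∃ (i : Fin n) (f : HAlg k B 1), f ∈ I ∧ u = ι i f) ∧ v = 0)),
      (∀ (K : Fin (n - 1)) (z : HAlg k B n),
        σbar K (RingQuot.mkAlgHom k _ z) = RingQuot.mkAlgHom k _ (σ K z)) ∧
      ∃ ρbar : BraidGroup n →*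
          (RingQuot (fun u v : HAlg k B n =>
              (∃ (i : Fin n) (f : HAlg k B 1), f ∈ I ∧ u = ι i f) ∧ v = 0) ≃ₐ[k]
            RingQuot (fun u v : HAlg k B n =>
              (∃ (i : Fin n) (f : HAlg k B 1), f ∈ I ∧ u = ι i f) ∧ v = 0)),
        ∀ K : Fin (n - 1), ρbar (braidGen K) = σbar K) := by
  have h_lo := fun K f (hf : f ∈ I) => (hσ K).apply_incl_lo hι (hIcorner f hf)
  have h_hi := fun K f (hf : f ∈ I) => (hσ K).apply_incl_hi hι (hIcorner f hf)
  have h_ne := fun (K : Fin (n - 1)) (i : Fin n) (h₁ : i ≠ lo K) (h₂ : i ≠ hi K) f =>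
    (hσ K).apply_incl_of_ne hι h₁ h₂ f
  refine ⟨fun K f hf => ⟨h_lo K f hf, h_hi K f hf, fun i h₁ h₂ => h_ne K i h₁ h₂ f⟩, ?_⟩
  set s : HAlg k B n → HAlg k B n → Prop := fun u v =>
    (∃ (i : Fin n) (f : HAlg k B 1), f ∈ I ∧ u = ι i f) ∧ v = 0 with hs
  have mk_incl : ∀ i, ∀ f ∈ I, RingQuot.mkAlgHom k s (ι i f) = 0 := fun i f hf => by
    simpa using RingQuot.mkAlgHom_rel k (s := s) ⟨⟨i, f, hf, rfl⟩, rfl⟩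
  have symm_conj : ∀ (K : Fin (n - 1)) (i j l : Fin n) (u : Bˣ), ∀ f ∈ I,
      σ K (ι i f) = bH k B n l (u : B) * ι j f * bH k B n l ((u⁻¹ : Bˣ) : B) →
      RingQuot.mkAlgHom k s ((σ K).symm (ι j f)) = 0 := by
    intro K i j l u f hf h
    have hj : ι j f = bH k B n l ((u⁻¹ : Bˣ) : B) * σ K (ι i f) * bH k B n l (u : B) := by
      have hc : ι j f = eH k B n 0 * ι j f * eH k B n 0 := by
        rw [← (hι j).1, ← map_mul, ← map_mul, hIcorner f hf]
      rw [h]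
      conv_lhs => rw [hc, ← bH_units_inv_mul l u]
      simp only [mul_assoc]
    rw [hj]
    simp [mk_incl i f hf]
  have descend : ∀ K : Fin (n - 1), ∃ τ : RingQuot s ≃ₐ[k] RingQuot s,
      ∀ z, τ (RingQuot.mkAlgHom k s z) = RingQuot.mkAlgHom k s (σ K z) := by
    intro K
    refine RingQuot.exists_algEquiv (σ K) ?_ ?_
    · rintro _ _ ⟨⟨i, f, hf, rfl⟩, rfl⟩
      rw [map_zero, map_zero]
      by_cases h₁ : i = lo K
      · rw [h₁, h_lo K f hf, map_mul, map_mul, mk_incl _ f hf, mul_zero, zero_mul]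
      by_cases h₂ : i = hi K
      · rw [h₂, h_hi K f hf, map_mul, map_mul, mk_incl _ f hf, mul_zero, zero_mul]
      rw [h_ne K i h₁ h₂, mk_incl i f hf]
    · rintro _ _ ⟨⟨i, f, hf, rfl⟩, rfl⟩
      rw [map_zero, map_zero]
      by_cases h₁ : i = lo K
      · exact h₁ ▸ symm_conj K _ _ _ y f hf (h_hi K f hf)
      by_cases h₂ : i = hi K
      · exact h₂ ▸ symm_conj K _ _ _ x f hf (h_lo K f hf)
      rw [(σ K).symm_apply_eq.2 (h_ne K i h₁ h₂ f).symm, mk_incl i f hf]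
  choose σbar hσbar using descend
  refine ⟨fun K z hz => ⟨?_, ?_⟩, σbar, hσbar, ?_⟩
  · rw [← hσbar, hz, map_zero]
  · apply (σbar K).injective
    rw [hσbar, AlgEquiv.apply_symm_apply, hz, map_zero]
  have bar_ext : ∀ τ τ' : RingQuot s ≃ₐ[k] RingQuot s,
      (∀ z, τ (RingQuot.mkAlgHom k s z) = τ' (RingQuot.mkAlgHom k s z)) → τ = τ' := by
    intro τ τ' h
    ext w
    obtain ⟨z, rfl⟩ := RingQuot.mkAlgHom_surjective k s w
    exact h z
  have rels : ∀ r ∈ braidRels (n - 1), FreeGroup.lift σbar r = 1 := by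
    rintro r (⟨i, j, hij, rfl⟩ | ⟨i, j, hij, rfl⟩)
    · have h := (hσ i).braid hcomm hij (hσ j)
      rw [map_mul, map_inv, mul_inv_eq_one]
      simp only [map_mul, FreeGroup.lift_apply_of]
      refine bar_ext _ _ fun z => ?_
      simpa [hσbar] using congrArg (RingQuot.mkAlgHom k s) (DFunLike.congr_fun h z)
    · have h := (hσ i).comm hij (hσ j)
      rw [map_mul, map_inv, mul_inv_eq_one, map_mul, map_inv, mul_inv_eq_iff_eq_mul]
      simp only [map_mul, FreeGroup.lift_apply_of]
      refine bar_ext _ _ fun z => ?_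
      simpa [hσbar] using congrArg (RingQuot.mkAlgHom k s) (DFunLike.congr_fun h z)
  exact ⟨PresentedGroup.toGroup rels, fun K => PresentedGroup.toGroup.of rels⟩
end

section
/- Let σ : F₂ → F₂ be the Artin automorphism of the free group on x₁, x₂ given by x₁ ↦ x₁x₂x₁^{-1}, x₂ ↦ x₁. Then σ is a cocartesian Yang–Baxter operator on F₁ in the category of groups (it is invertible and satisfies σ₂₃σ₁₂σ₂₃ = σ₁₂σ₂₃σ₁₂ on F₃), and it is Wada with trivial torsion: the coequalizer of the two homomorphisms i₂, σ∘i₂ : F₁ → F₂ is the quotient map q : F₂ → F₂/N, where N is the normal closure of x₁x₂^{-1}; the homomorphism j' : F₁ → F₂/N sending the generator x to q(x₁) is an isomorphism; and q(σ(x₁)) = q(x₁), so that the torsion χ(σ) = (j')^{-1} ∘ q ∘ σ ∘ i₁ is the identity of F₁. -/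
/-!
STATEMENT 17: The Artin automorphism `σ : F₂ → F₂`, `x₁ ↦ x₁x₂x₁⁻¹, x₂ ↦ x₁`,
is a cocartesian Yang–Baxter operator on `F₁` in the category of groups, and it is
Wada with trivial torsion: the coequalizer of `i₂, σ∘i₂ : F₁ → F₂` is the quotient
map `q : F₂ → F₂/N` where `N` is the normal closure of `x₁x₂⁻¹`; the map
`j' : F₁ → F₂/N`, `x ↦ q(x₁)`, is an isomorphism; and `q(σ(x₁)) = q(x₁)`, so the
torsion `χ(σ) = (j')⁻¹ ∘ q ∘ σ ∘ i₁` is the identity of `F₁`.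
-/

/-- `F₁`: the free group on one generator. -/
abbrev FG1 : Type := FreeGroup Unit
/-- `F₂ = F₁ ⊔ F₁`: the free group on `x₁, x₂`. -/
abbrev FG2 : Type := FreeGroup (Fin 2)
/-- `F₃`: the threefold coproduct of `F₁`. -/
abbrev FG3 : Type := FreeGroup (Fin 3)

/-- `x₁ ∈ F₂`. -/
def xx1 : FG2 := FreeGroup.of 0
/-- `x₂ ∈ F₂`. -/
def xx2 : FG2 := FreeGroup.of 1

/-- The Artin Yang–Baxter operator `σ : F₂ → F₂`, `x₁ ↦ x₁x₂x₁⁻¹`, `x₂ ↦ x₁`. -/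
def artinSigma : FG2 →* FG2 :=
  FreeGroup.lift fun i => if i = 0 then xx1 * xx2 * xx1⁻¹ else xx1

/-- First coproduct inclusion `i₁ : F₁ → F₂`. -/
def inc1 : FG1 →* FG2 := FreeGroup.lift fun _ => xx1
/-- Second coproduct inclusion `i₂ : F₁ → F₂`. -/
def inc2 : FG1 →* FG2 := FreeGroup.lift fun _ => xx2

/-- `σ₁₂ : F₃ → F₃`, applying `σ` to the generators `x₁, x₂`. -/
def artinSigma12 : FG3 →* FG3 :=
  FreeGroup.lift fun i =>
    if i = 0 then FreeGroup.of 0 * FreeGroup.of 1 * (FreeGroup.of 0)⁻¹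
    else if i = 1 then FreeGroup.of 0 else FreeGroup.of 2

/-- `σ₂₃ : F₃ → F₃`, applying `σ` to the generators `x₂, x₃`. -/
def artinSigma23 : FG3 →* FG3 :=
  FreeGroup.lift fun i =>
    if i = 0 then FreeGroup.of 0
    else if i = 1 then FreeGroup.of 1 * FreeGroup.of 2 * (FreeGroup.of 1)⁻¹
    else FreeGroup.of 1

/-- `N`: the normal closure of `x₁x₂⁻¹` in `F₂`. -/
def Ncl : Subgroup FG2 := Subgroup.normalClosure {xx1 * xx2⁻¹}

instance : Ncl.Normal := Subgroup.normalClosure_normal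

/-- The quotient map `q : F₂ → F₂/N`. -/
def qmap : FG2 →* FG2 ⧸ Ncl := QuotientGroup.mk' Ncl

/-- `j' : F₁ → F₂/N`, sending the generator `x` to `q(x₁)`. -/
def jprime : FG1 →* FG2 ⧸ Ncl := qmap.comp inc1

@[simp]
theorem artinSigma_xx1 : artinSigma xx1 = xx1 * xx2 * xx1⁻¹ := by
  simp [artinSigma, xx1]

@[simp]
theorem artinSigma_xx2 : artinSigma xx2 = xx1 := by
  simp [artinSigma, xx2]

@[simp]
theorem inc1_of (u : Unit) : inc1 (FreeGroup.of u) = xx1 := by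
  simp [inc1]

@[simp]
theorem inc2_of (u : Unit) : inc2 (FreeGroup.of u) = xx2 := by
  simp [inc2]

/-- Homomorphisms out of `F₂` are determined by the images of `x₁` and `x₂`. -/
theorem FG2.hom_ext {G : Type*} [Monoid G] {f g : FG2 →* G} (h₁ : f xx1 = g xx1)
    (h₂ : f xx2 = g xx2) : f = g := by
  refine FreeGroup.ext_hom _ _ fun i => ?_
  fin_cases i
  exacts [h₁, h₂]

/-- The inverse of the Artin automorphism: `x₁ ↦ x₂`, `x₂ ↦ x₂⁻¹x₁x₂`. -/
def artinSigmaInv : FG2 →* FG2 :=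
  FreeGroup.lift fun i => if i = 0 then xx2 else xx2⁻¹ * xx1 * xx2

@[simp]
theorem artinSigmaInv_xx1 : artinSigmaInv xx1 = xx2 := by
  simp [artinSigmaInv, xx1]

@[simp]
theorem artinSigmaInv_xx2 : artinSigmaInv xx2 = xx2⁻¹ * xx1 * xx2 := by
  simp [artinSigmaInv, xx2]

theorem artinSigma_bijective : Function.Bijective artinSigma := by
  have hl : artinSigmaInv.comp artinSigma = MonoidHom.id FG2 :=
    FG2.hom_ext (by simp [mul_assoc]) (by simp)
  have hr : artinSigma.comp artinSigmaInv = MonoidHom.id FG2 :=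
    FG2.hom_ext (by simp) (by simp [mul_assoc])
  exact Function.bijective_iff_has_inverse.2
    ⟨artinSigmaInv, DFunLike.congr_fun hl, DFunLike.congr_fun hr⟩

theorem artinSigma_yangBaxter :
    artinSigma23.comp (artinSigma12.comp artinSigma23) =
      artinSigma12.comp (artinSigma23.comp artinSigma12) := by
  refine FreeGroup.ext_hom _ _ fun i => ?_
  fin_cases i <;> simp [artinSigma12, artinSigma23, mul_assoc]

theorem qmap_xx1_eq_qmap_xx2 : qmap xx1 = qmap xx2 := by
  rw [← mul_inv_eq_one, ← map_inv, ← map_mul]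
  exact (QuotientGroup.eq_one_iff _).2 (Subgroup.subset_normalClosure rfl)

theorem Ncl_le_ker {G : Type*} [Group G] (h : FG2 →* G) (hh : h xx1 = h xx2) :
    Ncl ≤ h.ker := by
  refine Subgroup.normalClosure_le_normal ?_
  rintro _ rfl
  simp [MonoidHom.mem_ker, hh]

theorem existsUnique_comp_qmap {G : Type*} [Group G] (h : FG2 →* G) (hh : h xx1 = h xx2) :
    ∃! h' : FG2 ⧸ Ncl →* G, h'.comp qmap = h :=
  ⟨QuotientGroup.lift Ncl h (Ncl_le_ker h hh), MonoidHom.ext fun _ => rfl,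
    fun _ hg => QuotientGroup.monoidHom_ext _ (hg.trans (MonoidHom.ext fun _ => rfl))⟩

theorem jprime_bijective : Function.Bijective jprime := by
  let f : FG2 →* FG1 := FreeGroup.lift fun _ => FreeGroup.of ()
  have h₁ : f xx1 = FreeGroup.of () := by simp [f, xx1]
  have h₂ : f xx2 = FreeGroup.of () := by simp [f, xx2]
  obtain ⟨g, hg, -⟩ := existsUnique_comp_qmap f (h₁.trans h₂.symm)
  have hgq : ∀ w, g (qmap w) = f w := DFunLike.congr_fun hg
  have hl : g.comp jprime = MonoidHom.id FG1 :=
    FreeGroup.ext_hom _ _ fun _ => by simp [jprime, hgq, h₁]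
  have hr : (jprime.comp g).comp qmap = qmap :=
    FG2.hom_ext (by simp [jprime, hgq, h₁])
      (by simp [jprime, hgq, h₂, qmap_xx1_eq_qmap_xx2])
  refine Function.bijective_iff_has_inverse.2 ⟨g, DFunLike.congr_fun hl, fun y => ?_⟩
  obtain ⟨w, rfl⟩ := QuotientGroup.mk'_surjective Ncl y
  exact DFunLike.congr_fun hr w

theorem qmap_artinSigma_xx1 : qmap (artinSigma xx1) = qmap xx1 := by
  simp [qmap_xx1_eq_qmap_xx2]

theorem statement17 :
    -- σ is invertible
    Function.Bijective artinSigma ∧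
    -- σ satisfies the Yang-Baxter equation σ₂₃σ₁₂σ₂₃ = σ₁₂σ₂₃σ₁₂ on F₃
    (∀ w : FG3, artinSigma23 (artinSigma12 (artinSigma23 w)) =
        artinSigma12 (artinSigma23 (artinSigma12 w))) ∧
    -- q coequalizes i₂ and σ∘i₂
    (∀ t : FG1, qmap (inc2 t) = qmap (artinSigma (inc2 t))) ∧
    -- and q is *the* coequalizer: universal among maps coequalizing i₂ and σ∘i₂
    (∀ (G : Type) (_ : Group G) (h : FG2 →* G),
      (∀ t : FG1, h (inc2 t) = h (artinSigma (inc2 t))) →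
        ∃! h' : FG2 ⧸ Ncl →* G, h'.comp qmap = h) ∧
    -- j' : F₁ → F₂/N is an isomorphism (σ is Wada)
    Function.Bijective jprime ∧
    -- q(σ(x₁)) = q(x₁)
    qmap (artinSigma xx1) = qmap xx1 ∧
    -- hence the torsion (j')⁻¹ ∘ q ∘ σ ∘ i₁ is the identity of F₁:
    (∀ t : FG1, qmap (artinSigma (inc1 t)) = jprime t) := by
  refine ⟨artinSigma_bijective, DFunLike.congr_fun artinSigma_yangBaxter, ?_, ?_,
    jprime_bijective, qmap_artinSigma_xx1, ?_⟩
  · have h : qmap.comp inc2 = (qmap.comp artinSigma).comp inc2 :=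
      FreeGroup.ext_hom _ _ fun _ => by simp [qmap_xx1_eq_qmap_xx2]
    exact DFunLike.congr_fun h
  · intro G _ h hh
    exact existsUnique_comp_qmap h (by simpa using (hh (FreeGroup.of ())).symm)
  · have h : (qmap.comp artinSigma).comp inc1 = jprime :=
      FreeGroup.ext_hom _ _ fun _ => by simp [jprime, qmap_xx1_eq_qmap_xx2]
    exact DFunLike.congr_fun h
end
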